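/- arXiv:1802.08715 — 10 statements merged into one kernel-verified Lean document; each statement's English description precedes it below -/
import Mathlib

section
/- Assume in addition that F is unimodal, i.e., there exists m∈ℝ such that F is convex on (−∞,m] and concave on [m,∞). Fix a sample size n, a mixture weight ε∈(0,1/2] and a level α∈(0,1). Then the power of the oracle scan test is monotone in the shift: for any shifts 0 ≤ μ₁ ≤ μ₂, sup_{s≤t} P(Binomial(n, q_{s,t}(μ₁)) ≥ c_{s,t}) ≤ sup_{s≤t} P(Binomial(n, q_{s,t}(μ₂)) ≥ c_{s,t}). -/
open Filter MeasureTheory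

/-- Upper tail of the binomial distribution: `P(Binomial(n,p) ≥ c)`. -/
noncomputable def binomTail (n : ℕ) (p : ℝ) (c : ℕ) : ℝ :=
  ∑ k ∈ Finset.Icc c n, (n.choose k : ℝ) * p ^ k * (1 - p) ^ (n - k)

/-- Level-`α` critical value: the smallest `c : ℕ` with `P(Binomial(n,p) ≥ c) ≤ α`. -/
noncomputable def critVal (n : ℕ) (p α : ℝ) : ℕ :=
  sInf {c : ℕ | binomTail n p c ≤ α}

theorem binomTail_zero' (n : ℕ) (p : ℝ) : binomTail n p 0 = 1 := by
  unfold binomTail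
  have h := add_pow p (1 - p) n
  rw [add_sub_cancel, one_pow] at h
  refine Eq.trans ?_ h.symm
  rw [Finset.range_eq_Ico]
  refine Finset.sum_congr (by ext k; simp) ?_
  intro k _
  ring

theorem binomTail_succ' (n : ℕ) (p : ℝ) (c : ℕ) :
    binomTail (n + 1) p (c + 1) = p * binomTail n p c + (1 - p) * binomTail n p (c + 1) := by
  unfold binomTail
  have e1 : ∀ (f : ℕ → ℝ) (N : ℕ),
      ∑ k ∈ Finset.Icc (c + 1) (N + 1), f k = ∑ k ∈ Finset.Icc c N, f (k + 1) := by
    intro f N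
    rw [← Finset.map_add_right_Icc, Finset.sum_map]
    rfl
  have e2 : ∑ k ∈ Finset.Icc (c + 1) n, (n.choose k : ℝ) * p ^ k * (1 - p) ^ (n + 1 - k)
      = ∑ k ∈ Finset.Icc (c + 1) (n + 1), (n.choose k : ℝ) * p ^ k * (1 - p) ^ (n + 1 - k) := by
    refine Finset.sum_subset (Finset.Icc_subset_Icc_right (by omega)) ?_
    intro k hk hk'
    simp only [Finset.mem_Icc] at hk hk'
    rw [Nat.choose_eq_zero_of_lt (by omega)]
    simp
  have e3 : (1 - p) * ∑ k ∈ Finset.Icc (c + 1) n, (n.choose k : ℝ) * p ^ k * (1 - p) ^ (n - k)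
      = ∑ k ∈ Finset.Icc (c + 1) n, (n.choose k : ℝ) * p ^ k * (1 - p) ^ (n + 1 - k) := by
    rw [Finset.mul_sum]
    refine Finset.sum_congr rfl ?_
    intro k hk
    simp only [Finset.mem_Icc] at hk
    rw [Nat.sub_add_comm hk.2, pow_succ]
    ring
  rw [e3, e2, e1, e1, Finset.mul_sum, ← Finset.sum_add_distrib]
  refine Finset.sum_congr rfl ?_
  intro k hk
  rw [Nat.choose_succ_succ, Nat.add_sub_add_right]
  push_cast
  ring

theorem binomTail_anti (n : ℕ) {p : ℝ} (h0 : 0 ≤ p) (h1 : p ≤ 1) {c d : ℕ} (h : c ≤ d) :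
    binomTail n p d ≤ binomTail n p c := by
  unfold binomTail
  refine Finset.sum_le_sum_of_subset_of_nonneg (Finset.Icc_subset_Icc_left h) ?_
  intro k _ _
  have : 0 ≤ 1 - p := by linarith
  positivity

theorem binomTail_mono (n : ℕ) {p q : ℝ} (h0 : 0 ≤ p) (hpq : p ≤ q) (h1 : q ≤ 1) :
    ∀ c : ℕ, binomTail n p c ≤ binomTail n q c := by
  induction n with
  | zero =>
    intro c
    cases c with
    | zero => rw [binomTail_zero', binomTail_zero']
    | succ c => simp [binomTail]
  | succ n ih =>
    intro c
    cases c with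
    | zero => rw [binomTail_zero', binomTail_zero']
    | succ c =>
      rw [binomTail_succ', binomTail_succ']
      have a := ih c
      have b := ih (c + 1)
      have d := binomTail_anti n (h0.trans hpq) h1 (Nat.le_succ c)
      have d' := binomTail_anti n h0 (hpq.trans h1) (Nat.le_succ c)
      simp only [Nat.succ_eq_add_one] at d d'
      nlinarith [mul_le_mul_of_nonneg_left a h0,
        mul_le_mul_of_nonneg_left b (by linarith : 0 ≤ 1 - p),
        mul_nonneg (sub_nonneg.2 hpq) (sub_nonneg.2 d)]

theorem convex_incr {F : ℝ → ℝ} {S : Set ℝ} (hF : ConvexOn ℝ S F) {s t δ : ℝ} (hst : s ≤ t)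
    (hδ : 0 ≤ δ) (hs : s ∈ S) (ht : t + δ ∈ S) :
    F (s + δ) - F s ≤ F (t + δ) - F t := by
  rcases eq_or_lt_of_le (add_nonneg (sub_nonneg.2 hst) hδ) with h | h
  · have h1 : s = t := by linarith
    have h2 : δ = 0 := by linarith
    subst h1 h2
    simp
  · have hne : t - s + δ ≠ 0 := h.ne'
    have A := hF.2 hs ht
      (show 0 ≤ (t - s) / (t - s + δ) from div_nonneg (by linarith) h.le)
      (show 0 ≤ δ / (t - s + δ) from div_nonneg hδ h.le) (by field_simp)
    have B := hF.2 hs ht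
      (show 0 ≤ δ / (t - s + δ) from div_nonneg hδ h.le)
      (show 0 ≤ (t - s) / (t - s + δ) from div_nonneg (by linarith) h.le) (by field_simp; ring)
    simp only [smul_eq_mul] at A B
    have eA : (t - s) / (t - s + δ) * s + δ / (t - s + δ) * (t + δ) = s + δ := by
      field_simp; ring
    have eB : δ / (t - s + δ) * s + (t - s) / (t - s + δ) * (t + δ) = t := by
      field_simp; ring
    rw [eA] at A
    rw [eB] at B
    have hs1 : (t - s) / (t - s + δ) + δ / (t - s + δ) = 1 := by field_simp
    have : (t - s) / (t - s + δ) = 1 - δ / (t - s + δ) := by linarith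
    rw [this] at A B
    linarith

theorem concave_incr {F : ℝ → ℝ} {S : Set ℝ} (hF : ConcaveOn ℝ S F) {s t δ : ℝ} (hst : s ≤ t)
    (hδ : 0 ≤ δ) (hs : s ∈ S) (ht : t + δ ∈ S) :
    F (t + δ) - F t ≤ F (s + δ) - F s := by
  have := convex_incr hF.neg hst hδ hs ht
  simp only [Pi.neg_apply] at this
  linarith

theorem unimodal_shift {F : ℝ → ℝ} {m : ℝ} (hconvex : ConvexOn ℝ (Set.Iic m) F)
    (hconcave : ConcaveOn ℝ (Set.Ici m) F) {s t δ μ : ℝ} (hst : s ≤ t) (hδ : 0 ≤ δ) (hμ : 0 ≤ μ)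
    (h : F t - F s < F (t + δ) - F (s + δ)) :
    F (t - μ) - F (s - μ) ≤ F t - F s := by
  have inc : ∀ x y : ℝ, x ≤ y → t + y ≤ m → F (t + x) - F (s + x) ≤ F (t + y) - F (s + y) := by
    intro x y hxy hy
    have := convex_incr hconvex (s := s + x) (t := t + x) (δ := y - x) (by linarith)
      (by linarith) (Set.mem_Iic.2 (by linarith)) (Set.mem_Iic.2 (by linarith))
    rw [show s + x + (y - x) = s + y by ring, show t + x + (y - x) = t + y by ring] at this
    linarith
  have dec : ∀ x y : ℝ, x ≤ y → m ≤ s + x → F (t + y) - F (s + y) ≤ F (t + x) - F (s + x) := by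
    intro x y hxy hy
    have := concave_incr hconcave (s := s + x) (t := t + x) (δ := y - x) (by linarith)
      (by linarith) (Set.mem_Ici.2 (by linarith)) (Set.mem_Ici.2 (by linarith))
    rw [show s + x + (y - x) = s + y by ring, show t + x + (y - x) = t + y by ring] at this
    linarith
  rcases le_or_gt t m with htm | htm
  · simpa [sub_eq_add_neg] using inc (-μ) 0 (by linarith) (by linarith)
  rcases le_or_gt m s with hsm | hsm
  · have := dec 0 δ hδ (by linarith)
    simp only [add_zero] at this
    linarith
  obtain ⟨d, hd0, hdm, hd⟩ : ∃ d, 0 ≤ d ∧ s + d ≤ m ∧ F t - F s < F (t + d) - F (s + d) := by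
    rcases le_or_gt (s + δ) m with h1 | h1
    · exact ⟨δ, hδ, h1, h⟩
    · exact ⟨m - s, by linarith, by linarith,
        h.trans_le (dec (m - s) δ (by linarith) (by linarith))⟩
  obtain ⟨u, hu0, hum, hu⟩ : ∃ u, 0 ≤ u ∧ m ≤ t - u ∧
      F (t - μ) - F (s - μ) ≤ F (t - u) - F (s - u) := by
    rcases le_or_gt m (t - μ) with h1 | h1
    · exact ⟨μ, hμ, h1, le_rfl⟩
    · refine ⟨t - m, by linarith, by linarith, ?_⟩
      simpa [sub_eq_add_neg] using inc (-μ) (-(t - m)) (by linarith) (by linarith)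
  refine hu.trans ?_
  have hdpos : 0 < d := by
    rcases eq_or_lt_of_le hd0 with h1 | h1
    · subst h1; simp at hd
    · exact h1
  have hp : 0 < u + d := by linarith
  have A := hconcave.2 (show t - u ∈ Set.Ici m from hum)
    (show t + d ∈ Set.Ici m from Set.mem_Ici.2 (by linarith))
    (show 0 ≤ d / (u + d) by positivity) (show 0 ≤ u / (u + d) by positivity) (by field_simp; ring)
  have B := hconvex.2 (show s - u ∈ Set.Iic m from Set.mem_Iic.2 (by linarith))
    (show s + d ∈ Set.Iic m from hdm)
    (show 0 ≤ d / (u + d) by positivity) (show 0 ≤ u / (u + d) by positivity) (by field_simp; ring)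
  simp only [smul_eq_mul] at A B
  have eA : d / (u + d) * (t - u) + u / (u + d) * (t + d) = t := by field_simp; ring
  have eB : d / (u + d) * (s - u) + u / (u + d) * (s + d) = s := by field_simp; ring
  rw [eA] at A
  rw [eB] at B
  have hw : u / (u + d) = 1 - d / (u + d) := by field_simp; ring
  have hw0 : 0 < d / (u + d) := by positivity
  have hw1 : 0 ≤ u / (u + d) := by positivity
  rw [hw] at A B hw1
  nlinarith [mul_nonneg hw1 (sub_nonneg.2 hd.le)]

/-- If `F` is unimodal (convex then concave), the power of the oracle scan test is
monotone in the shift. -/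
theorem oracle_scan_power_monotone
    (F : ℝ → ℝ) (hFcont : Continuous F) (hFmono : Monotone F)
    (hFbot : Tendsto F atBot (nhds 0)) (hFtop : Tendsto F atTop (nhds 1))
    (m : ℝ) (hconvex : ConvexOn ℝ (Set.Iic m) F) (hconcave : ConcaveOn ℝ (Set.Ici m) F)
    (n : ℕ) (ε : ℝ) (hε : ε ∈ Set.Ioc (0 : ℝ) (1 / 2))
    (α : ℝ) (hα : α ∈ Set.Ioo (0 : ℝ) 1)
    (μ₁ μ₂ : ℝ) (hμ₁ : 0 ≤ μ₁) (hμ : μ₁ ≤ μ₂) :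
    sSup {x : ℝ | ∃ s t : ℝ, s ≤ t ∧
        x = binomTail n ((1 - ε) * (F t - F s) + ε * (F (t - μ₁) - F (s - μ₁)))
              (critVal n (F t - F s) α)} ≤
    sSup {x : ℝ | ∃ s t : ℝ, s ≤ t ∧
        x = binomTail n ((1 - ε) * (F t - F s) + ε * (F (t - μ₂) - F (s - μ₂)))
              (critVal n (F t - F s) α)} := by
  have F0 : ∀ x, 0 ≤ F x := fun x => hFmono.le_of_tendsto hFbot x
  have F1 : ∀ x, F x ≤ 1 := fun x => hFmono.ge_of_tendsto hFtop x
  obtain ⟨he0, he1⟩ := hε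
  have G0 : ∀ s t, s ≤ t → 0 ≤ F t - F s := fun s t h => sub_nonneg.2 (hFmono h)
  have G1 : ∀ s t, F t - F s ≤ 1 := fun s t => by linarith [F0 s, F1 t]
  have Q0 : ∀ a b : ℝ, 0 ≤ a → 0 ≤ b → 0 ≤ (1 - ε) * a + ε * b := fun a b ha hb =>
    add_nonneg (mul_nonneg (by linarith) ha) (mul_nonneg he0.le hb)
  have Q1 : ∀ a b c : ℝ, a ≤ c → b ≤ c → (1 - ε) * a + ε * b ≤ c := fun a b c ha hb => by
    nlinarith [mul_nonneg (by linarith : 0 ≤ 1 - ε) (sub_nonneg.2 ha),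
      mul_nonneg he0.le (sub_nonneg.2 hb)]
  have bdd : BddAbove {x : ℝ | ∃ s t : ℝ, s ≤ t ∧
        x = binomTail n ((1 - ε) * (F t - F s) + ε * (F (t - μ₂) - F (s - μ₂)))
              (critVal n (F t - F s) α)} := by
    refine ⟨1, ?_⟩
    rintro x ⟨s, t, hst, rfl⟩
    exact (binomTail_anti n (Q0 _ _ (G0 _ _ hst) (G0 _ _ (by linarith)))
      (Q1 _ _ _ (G1 _ _) (G1 _ _)) (Nat.zero_le _)).trans_eq (binomTail_zero' n _)
  have key : ∀ s t a, s ≤ t → F t - F s = a → ∀ q, 0 ≤ q →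
      q ≤ (1 - ε) * a + ε * (F (t - μ₂) - F (s - μ₂)) →
      binomTail n q (critVal n a α) ≤ sSup {x : ℝ | ∃ s t : ℝ, s ≤ t ∧
        x = binomTail n ((1 - ε) * (F t - F s) + ε * (F (t - μ₂) - F (s - μ₂)))
              (critVal n (F t - F s) α)} := by
    rintro s t a hst rfl q hq0 hq
    exact (binomTail_mono n hq0 hq (Q1 _ _ _ (G1 _ _) (G1 _ _)) _).trans
      (le_csSup bdd ⟨s, t, hst, rfl⟩)
  refine csSup_le ⟨_, 0, 0, le_rfl, rfl⟩ ?_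
  rintro x ⟨s, t, hst, rfl⟩
  set δ := μ₂ - μ₁ with hδdef
  have hδ : 0 ≤ δ := sub_nonneg.2 hμ
  rcases le_or_gt (F (t + δ) - F (s + δ)) (F t - F s) with h | h
  · obtain ⟨s', hs', hs'e⟩ : ∃ s' ∈ Set.Icc s (s + δ), F s' = F (t + δ) - (F t - F s) := by
      refine intermediate_value_Icc (by linarith) hFcont.continuousOn ⟨?_, ?_⟩
      · linarith [hFmono (by linarith : t ≤ t + δ)]
      · linarith
    refine key s' (t + δ) _ (by linarith [hs'.2]) (by linarith) _
      (Q0 _ _ (G0 _ _ hst) (G0 _ _ (by linarith))) ?_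
    have e : t + δ - μ₂ = t - μ₁ := by rw [hδdef]; ring
    rw [e]
    have := hFmono (by linarith [hs'.2] : s' - μ₂ ≤ s - μ₁)
    gcongr
  · have hb := unimodal_shift hconvex hconcave hst hδ hμ₁ h
    have ha1 : F t - F s < 1 := h.trans_le (G1 _ _)
    have ha0 := G0 s t hst
    refine (binomTail_mono n (q := F t - F s) (Q0 _ _ (G0 _ _ hst) (G0 _ _ (by linarith)))
      (Q1 _ _ _ le_rfl hb) ha1.le _).trans ?_
    generalize F t - F s = a at ha1 ha0
    have hT : Tendsto (fun T => binomTail n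
        ((1 - ε) * a + ε * max 0 (a - (F T - F (T - μ₂)))) (critVal n a α)) atTop
        (nhds (binomTail n a (critVal n a α))) := by
      have hc : Continuous (fun p => binomTail n p (critVal n a α)) := by
        unfold binomTail
        fun_prop
      refine (hc.tendsto a).comp ?_
      have h2 : Tendsto (fun T => F (T - μ₂)) atTop (nhds 1) :=
        hFtop.comp (tendsto_atTop_add_const_right _ (-μ₂) tendsto_id)
      have h3 : Tendsto (fun T => (1 - ε) * a + ε * max 0 (a - (F T - F (T - μ₂)))) atTop
          (nhds ((1 - ε) * a + ε * max 0 (a - (1 - 1)))) :=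
        ((tendsto_const_nhds.max (tendsto_const_nhds.sub (hFtop.sub h2))).const_mul _).const_add _
      have e : (1 - ε) * a + ε * max 0 (a - (1 - 1)) = a := by
        rw [sub_self, sub_zero, max_eq_right ha0]; ring
      rwa [e] at h3
    refine le_of_tendsto hT ?_
    filter_upwards [hFtop.eventually (lt_mem_nhds ha1)] with T hTa
    obtain ⟨r, hr, hrT⟩ : ∃ r, F r < F T - a ∧ r ≤ T :=
      ((hFbot.eventually (gt_mem_nhds (sub_pos.2 hTa))).and (eventually_le_atBot T)).exists
    obtain ⟨s', hs', hs'e⟩ : ∃ s' ∈ Set.Icc r T, F s' = F T - a :=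
      intermediate_value_Icc hrT hFcont.continuousOn ⟨hr.le, by linarith⟩
    refine key s' T a hs'.2 (by linarith) _ (Q0 _ _ ha0 (le_max_left _ _)) ?_
    have h4 := hFmono (by linarith : s' - μ₂ ≤ s')
    have h5 := G0 (s' - μ₂) (T - μ₂) (by linarith [hs'.2])
    have : max 0 (a - (F T - F (T - μ₂))) ≤ F (T - μ₂) - F (s' - μ₂) :=
      max_le h5 (by linarith)
    gcongr
end

section
/- Let α∈(0,1) and, for each n, let p_n, q_n ∈ [0,1] with p_n ≤ 1/2 and p_n ≤ q_n, and let c_n be the smallest c∈ℕ with P(Binomial(n,p_n) ≥ c) ≤ α. If n(q_n − p_n)²/q_n → ∞ as n → ∞ (in particular q_n > 0 eventually), then P(Binomial(n, q_n) ≥ c_n) → 1; that is, the most powerful level-α test of Binomial(n,p_n) versus Binomial(n,q_n), which rejects for large values of the count, is asymptotically powerful. -/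
open Filter

lemma aux_var (n : ℕ) (x : ℝ) :
    ∑ k ∈ Finset.range (n + 1), ((n : ℝ) * x - k) ^ 2 *
      ((n.choose k : ℝ) * x ^ k * (1 - x) ^ (n - k)) = n * x * (1 - x) := by
  have h := congrArg (Polynomial.eval x) (bernsteinPolynomial.variance ℝ n)
  simpa [Polynomial.eval_finsetSum, bernsteinPolynomial] using h

lemma aux_sum (n : ℕ) (x : ℝ) :
    ∑ k ∈ Finset.range (n + 1), ((n.choose k : ℝ) * x ^ k * (1 - x) ^ (n - k)) = 1 := by
  have h := congrArg (Polynomial.eval x) (bernsteinPolynomial.sum ℝ n)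
  simpa [Polynomial.eval_finsetSum, bernsteinPolynomial] using h

lemma aux_nonneg (n k : ℕ) (x : ℝ) (h0 : 0 ≤ x) (h1 : x ≤ 1) :
    0 ≤ (n.choose k : ℝ) * x ^ k * (1 - x) ^ (n - k) := by
  have : 0 ≤ 1 - x := by linarith
  positivity

lemma aux_cheb (n : ℕ) (x t : ℝ) (h0 : 0 ≤ x) (h1 : x ≤ 1) (S : Finset ℕ)
    (hS : S ⊆ Finset.range (n + 1)) (ht : ∀ k ∈ S, t ^ 2 ≤ ((n : ℝ) * x - k) ^ 2) :
    t ^ 2 * ∑ k ∈ S, ((n.choose k : ℝ) * x ^ k * (1 - x) ^ (n - k)) ≤ n * x * (1 - x) := by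
  rw [← aux_var, Finset.mul_sum]
  refine (Finset.sum_le_sum fun k hk => mul_le_mul_of_nonneg_right (ht k hk)
    (aux_nonneg n k x h0 h1)).trans ?_
  exact Finset.sum_le_sum_of_subset_of_nonneg hS
    fun k _ _ => mul_nonneg (sq_nonneg _) (aux_nonneg n k x h0 h1)

lemma aux_anti (n c d : ℕ) (x : ℝ) (h0 : 0 ≤ x) (h1 : x ≤ 1) (hcd : c ≤ d) :
    binomTail n x d ≤ binomTail n x c :=
  Finset.sum_le_sum_of_subset_of_nonneg (Finset.Icc_subset_Icc_left hcd)
    fun k _ _ => aux_nonneg n k x h0 h1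

lemma aux_le_one (n c : ℕ) (x : ℝ) (h0 : 0 ≤ x) (h1 : x ≤ 1) : binomTail n x c ≤ 1 := by
  rw [← aux_sum n x]
  refine Finset.sum_le_sum_of_subset_of_nonneg ?_ fun k _ _ => aux_nonneg n k x h0 h1
  intro k hk
  simp only [Finset.mem_Icc, Finset.mem_range] at *
  omega

lemma aux_main (n : ℕ) (α p q : ℝ) (hp0 : 0 ≤ p) (hp : p ≤ 1 / 2) (hq1 : q ≤ 1) (hpq : p ≤ q)
    (hT : 0 < n * (q - p) ^ 2 / q) (hα : 4 / (n * (q - p) ^ 2 / q) ≤ α) :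
    1 - 4 / (n * (q - p) ^ 2 / q) ≤ binomTail n q (critVal n p α) := by
  have hq : 0 < q := by
    rcases (hp0.trans hpq).lt_or_eq with h | h
    · exact h
    · rw [← h] at hT; simp at hT
  have hnum : 0 < n * (q - p) ^ 2 := by
    have := mul_pos hT hq
    rwa [div_mul_cancel₀ _ hq.ne'] at this
  have hn : (0 : ℝ) < n := by
    rcases (Nat.cast_nonneg (α := ℝ) n).lt_or_eq with h | h
    · exact h
    · rw [← h] at hnum; simp at hnum
  have hinv : 4 / (n * (q - p) ^ 2 / q) = 4 * q / (n * (q - p) ^ 2) := by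
    field_simp
  set t : ℝ := n * (q - p) / 2 with ht
  have ht0 : 0 ≤ t := by
    have : 0 ≤ q - p := by linarith
    positivity
  have ht2 : t ^ 2 = n * (n * (q - p) ^ 2) / 4 := by rw [ht]; ring
  have key : ∀ s v : ℝ, v ≤ n * q → t ^ 2 * s ≤ v →
      s ≤ 4 / (n * (q - p) ^ 2 / q) := by
    intro s v hv hs
    rw [hinv, le_div_iff₀ hnum]
    rw [ht2] at hs
    have : n * (s * (n * (q - p) ^ 2)) ≤ n * (4 * q) := by linarith
    exact le_of_mul_le_mul_left this hn
  set c := ⌈(n : ℝ) * (p + q) / 2⌉₊ with hc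
  have h1 : binomTail n p c ≤ 4 / (n * (q - p) ^ 2 / q) := by
    refine key _ (n * p * (1 - p)) ?_ (aux_cheb n p t hp0 (by linarith) _ ?_ ?_)
    · have : n * p ≤ n * q := by gcongr
      nlinarith [mul_nonneg hn.le (mul_nonneg hp0 hp0)]
    · intro k hk
      simp only [Finset.mem_Icc, Finset.mem_range] at *
      omega
    · intro k hk
      have : (n : ℝ) * (p + q) / 2 ≤ k := Nat.ceil_le.mp (Finset.mem_Icc.mp hk).1
      have h2 : t ≤ k - n * p := by rw [ht]; linarith
      nlinarith
  have hcrit : critVal n p α ≤ c := Nat.sInf_le (h1.trans hα)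
  refine le_trans ?_ (aux_anti n _ _ q hq.le hq1 hcrit)
  have hcn : c ≤ n := by
    rw [hc, Nat.ceil_le]
    nlinarith
  have h2 : ∑ k ∈ Finset.range c, ((n.choose k : ℝ) * q ^ k * (1 - q) ^ (n - k))
      ≤ 4 / (n * (q - p) ^ 2 / q) := by
    refine key _ (n * q * (1 - q)) ?_ (aux_cheb n q t hq.le hq1 _ ?_ ?_)
    · nlinarith [mul_nonneg hn.le (mul_nonneg hq.le hq.le)]
    · intro k hk
      simp only [Finset.mem_range] at *
      omega
    · intro k hk
      have : (k : ℝ) < (n : ℝ) * (p + q) / 2 := Nat.lt_ceil.mp (Finset.mem_range.mp hk)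
      have h2 : t ≤ n * q - k := by rw [ht]; linarith
      nlinarith
  have h3 : ∑ k ∈ Finset.range c, ((n.choose k : ℝ) * q ^ k * (1 - q) ^ (n - k))
      + binomTail n q c = 1 := by
    rw [binomTail, ← Finset.Ico_add_one_right_eq_Icc]
    exact (Finset.sum_range_add_sum_Ico
      (fun k => (n.choose k : ℝ) * q ^ k * (1 - q) ^ (n - k))
      (show c ≤ n + 1 by omega)).trans (aux_sum n q)
  linarith

/-- Testing `Bin(n,p_n)` vs `Bin(n,q_n)` with `p_n ≤ 1/2`, `p_n ≤ q_n`: if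
`n (q_n - p_n)² / q_n → ∞` then the test rejecting for large counts at level `α`
is asymptotically powerful. -/
theorem binomial_test_powerful
    (α : ℝ) (hα : α ∈ Set.Ioo (0 : ℝ) 1)
    (p q : ℕ → ℝ)
    (hp0 : ∀ n, 0 ≤ p n) (hp : ∀ n, p n ≤ 1 / 2)
    (hq1 : ∀ n, q n ≤ 1) (hpq : ∀ n, p n ≤ q n)
    (h : Tendsto (fun n : ℕ => n * (q n - p n) ^ 2 / q n) atTop atTop) :
    Tendsto (fun n : ℕ => binomTail n (q n) (critVal n (p n) α)) atTop (nhds 1) := by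
  have h4 : Tendsto (fun n : ℕ => 4 / (n * (q n - p n) ^ 2 / q n)) atTop (nhds 0) :=
    h.const_div_atTop 4
  have h5 : Tendsto (fun n : ℕ => 1 - 4 / (n * (q n - p n) ^ 2 / q n)) atTop (nhds 1) := by
    simpa using h4.const_sub 1
  refine tendsto_of_tendsto_of_tendsto_of_le_of_le' h5 tendsto_const_nhds ?_ ?_
  · filter_upwards [h.eventually_gt_atTop 0, h4.eventually_le_const hα.1] with n hn hn2
    exact aux_main n α (p n) (q n) (hp0 n) (hp n) (hq1 n) (hpq n) hn hn2
  · exact Eventually.of_forall fun n => aux_le_one n _ _ ((hp0 n).trans (hpq n)) (hq1 n)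
end

section
/- For each n, let p_n, q_n ∈ [0,1] with 0 < p_n ≤ 1/2 and p_n ≤ q_n. If n(q_n − p_n)²/p_n → 0 as n → ∞, then for every sequence (c_n) of natural numbers, P(Binomial(n, q_n) ≥ c_n) − P(Binomial(n, p_n) ≥ c_n) → 0; in particular, the level-α test that rejects when the count is at least the smallest c with P(Binomial(n,p_n) ≥ c) ≤ α is asymptotically powerless, its power exceeding its null rejection probability by a vanishing amount. -/
open Filter

lemma binom_sum_aux (n : ℕ) (a b : ℝ) :
    ∑ k ∈ Finset.range (n + 1), (n.choose k : ℝ) * a ^ k * b ^ (n - k) = (a + b) ^ n := by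
  rw [add_pow]
  exact Finset.sum_congr rfl fun k _ => by ring

lemma binom_key (n c : ℕ) (p q : ℝ) (hp0 : 0 < p) (hp : p ≤ 1 / 2) :
    (binomTail n q c - binomTail n p c) ^ 2 ≤ Real.exp (2 * (n * (q - p) ^ 2 / p)) - 1 := by
  have hp1 : 0 < 1 - p := by linarith
  set P : ℕ → ℝ := fun k => (n.choose k : ℝ) * p ^ k * (1 - p) ^ (n - k) with hP
  set Q : ℕ → ℝ := fun k => (n.choose k : ℝ) * q ^ k * (1 - q) ^ (n - k) with hQ
  have hPn : ∀ k, 0 ≤ P k := fun k => by simp only [hP]; positivity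
  have hPpos : ∀ k ∈ Finset.range (n + 1), 0 < P k := fun k hk => by
    have : 0 < n.choose k := Nat.choose_pos (Nat.lt_succ_iff.mp (Finset.mem_range.mp hk))
    simp only [hP]; positivity
  have hsub : Finset.Icc c n ⊆ Finset.range (n + 1) := fun k hk => by
    simp at hk ⊢; omega
  have hsP : ∑ k ∈ Finset.range (n + 1), P k = 1 := by
    simp only [hP]; rw [binom_sum_aux]; simp
  have hsQ : ∑ k ∈ Finset.range (n + 1), Q k = 1 := by
    simp only [hQ]; rw [binom_sum_aux]; simp
  have hsR : ∑ k ∈ Finset.range (n + 1), Q k ^ 2 / P k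
      = (q ^ 2 / p + (1 - q) ^ 2 / (1 - p)) ^ n := by
    rw [← binom_sum_aux]
    refine Finset.sum_congr rfl fun k hk => ?_
    have : (0 : ℝ) < n.choose k := by
      exact_mod_cast Nat.choose_pos (Nat.lt_succ_iff.mp (Finset.mem_range.mp hk))
    simp only [hP, hQ, div_pow]
    clear_value P Q
    generalize 1 - q = b
    field_simp
    try ring
  have hbase : q ^ 2 / p + (1 - q) ^ 2 / (1 - p) = (q - p) ^ 2 / (p * (1 - p)) + 1 := by
    field_simp
    ring
  have hle : (q - p) ^ 2 / (p * (1 - p)) ≤ 2 * ((q - p) ^ 2 / p) := by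
    rw [← mul_div_assoc, div_le_div_iff₀ (by positivity) hp0]
    have : 0 ≤ (q - p) ^ 2 * p * (1 - 2 * p) := by
      have : 0 ≤ 1 - 2 * p := by linarith
      positivity
    nlinarith
  have hchi : ∑ k ∈ Finset.range (n + 1), (Q k - P k) ^ 2 / P k
      ≤ Real.exp (2 * (n * (q - p) ^ 2 / p)) - 1 := by
    have h1 : ∑ k ∈ Finset.range (n + 1), (Q k - P k) ^ 2 / P k
        = ∑ k ∈ Finset.range (n + 1), (Q k ^ 2 / P k - 2 * Q k + P k) := by
      refine Finset.sum_congr rfl fun k hk => ?_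
      have := hPpos k hk
      field_simp
      ring
    rw [h1, Finset.sum_add_distrib, Finset.sum_sub_distrib, ← Finset.mul_sum, hsP, hsQ, hsR, hbase]
    have h2 : ((q - p) ^ 2 / (p * (1 - p)) + 1) ^ n ≤ Real.exp (2 * (n * (q - p) ^ 2 / p)) := by
      calc ((q - p) ^ 2 / (p * (1 - p)) + 1) ^ n
          ≤ (Real.exp (2 * ((q - p) ^ 2 / p))) ^ n := by
            refine pow_le_pow_left₀ (by positivity) ?_ n
            exact (Real.add_one_le_exp _).trans (Real.exp_le_exp.mpr hle)
        _ = _ := by rw [← Real.exp_nat_mul]; congr 1; ring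
    linarith
  have hcs : (∑ k ∈ Finset.Icc c n, (Q k - P k)) ^ 2
      ≤ (∑ k ∈ Finset.Icc c n, (Q k - P k) ^ 2 / P k) * ∑ k ∈ Finset.Icc c n, P k := by
    refine Finset.sum_sq_le_sum_mul_sum_of_sq_eq_mul _ (fun k _ => ?_) (fun k _ => hPn k)
      fun k hk => ?_
    · exact div_nonneg (sq_nonneg _) (hPn k)
    · rw [div_mul_cancel₀ _ (hPpos k (hsub hk)).ne']
  have hA : ∑ k ∈ Finset.Icc c n, (Q k - P k) ^ 2 / P k
      ≤ ∑ k ∈ Finset.range (n + 1), (Q k - P k) ^ 2 / P k :=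
    Finset.sum_le_sum_of_subset_of_nonneg hsub fun k _ _ => div_nonneg (sq_nonneg _) (hPn k)
  have hA0 : 0 ≤ ∑ k ∈ Finset.Icc c n, (Q k - P k) ^ 2 / P k :=
    Finset.sum_nonneg fun k _ => div_nonneg (sq_nonneg _) (hPn k)
  have hB : ∑ k ∈ Finset.Icc c n, P k ≤ 1 :=
    hsP ▸ Finset.sum_le_sum_of_subset_of_nonneg hsub fun k _ _ => hPn k
  have : binomTail n q c - binomTail n p c = ∑ k ∈ Finset.Icc c n, (Q k - P k) := by
    rw [Finset.sum_sub_distrib]; rfl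
  rw [this]
  exact hcs.trans ((mul_le_of_le_one_right hA0 hB).trans (hA.trans hchi))

/-- Testing `Bin(n,p_n)` vs `Bin(n,q_n)` with `0 < p_n ≤ 1/2`, `p_n ≤ q_n ≤ 1`: if
`n (q_n - p_n)² / p_n → 0` then for any sequence of critical values the power exceeds
the null rejection probability by a vanishing amount (the test is asymptotically
powerless). -/
theorem binomial_test_powerless
    (p q : ℕ → ℝ)
    (hp0 : ∀ n, 0 < p n) (hp : ∀ n, p n ≤ 1 / 2)
    (hq1 : ∀ n, q n ≤ 1) (hpq : ∀ n, p n ≤ q n)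
    (h : Tendsto (fun n : ℕ => n * (q n - p n) ^ 2 / p n) atTop (nhds 0)) :
    ∀ c : ℕ → ℕ,
      Tendsto (fun n : ℕ => binomTail n (q n) (c n) - binomTail n (p n) (c n))
        atTop (nhds 0) := by
  intro c
  have hlim : Tendsto (fun n : ℕ => Real.exp (2 * (n * (q n - p n) ^ 2 / p n)) - 1)
      atTop (nhds 0) := by
    have := ((Real.continuous_exp.tendsto _).comp (h.const_mul 2)).sub_const 1
    simpa using this
  have hsq : Tendsto (fun n : ℕ => (binomTail n (q n) (c n) - binomTail n (p n) (c n)) ^ 2)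
      atTop (nhds 0) :=
    squeeze_zero (fun n => sq_nonneg _)
      (fun n => binom_key n (c n) (p n) (q n) (hp0 n) (hp n)) hlim
  have h3 := (Real.continuous_sqrt.tendsto _).comp hsq
  simp only [Real.sqrt_zero] at h3
  rw [tendsto_zero_iff_abs_tendsto_zero]
  refine h3.congr fun n => ?_
  simp [Real.sqrt_sq_eq_abs]
end

section
/- Assume the asymptotic regime nε_n → ∞ and √n·ε_n → 0. Suppose there is a sequence of thresholds (t_n) with F̄(t_n) > 0 such that nε_n F̄(t_n − μ_n) → ∞ and nε_n² F̄(t_n − μ_n)²/F̄(t_n) → ∞. Then for every level α∈(0,1), P(Binomial(n, q_{t_n}(μ_n)) ≥ c_{t_n}) → 1, where c_{t_n} is the level-α critical value computed from Binomial(n, F̄(t_n)); that is, the oracle threshold test is asymptotically powerful. -/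
open Filter

theorem bt_variance (n : ℕ) (p : ℝ) :
    ∑ k ∈ Finset.range (n+1), ((n:ℝ) * p - k)^2 * ((n.choose k : ℝ) * p ^ k * (1 - p) ^ (n - k))
      = n * p * (1 - p) := by
  have h := congrArg (Polynomial.eval p) (bernsteinPolynomial.variance ℝ n)
  simp only [Polynomial.eval_finsetSum, bernsteinPolynomial] at h
  simpa using h

theorem bt_total (n : ℕ) (p : ℝ) :
    ∑ k ∈ Finset.range (n+1), ((n.choose k : ℝ) * p ^ k * (1 - p) ^ (n - k)) = 1 := by
  have h := congrArg (Polynomial.eval p) (bernsteinPolynomial.sum ℝ n)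
  simp only [Polynomial.eval_finsetSum, bernsteinPolynomial] at h
  simpa using h

theorem bt_cheb (n : ℕ) (p a : ℝ) (hp : 0 ≤ p) (hp1 : p ≤ 1) (ha : 0 < a) (S : Finset ℕ)
    (hS : S ⊆ Finset.range (n+1)) (hSa : ∀ k ∈ S, a^2 ≤ ((n:ℝ) * p - k)^2) :
    ∑ k ∈ S, ((n.choose k : ℝ) * p ^ k * (1 - p) ^ (n - k)) ≤ n * p / a^2 := by
  have hq : 0 ≤ 1 - p := by linarith
  have hw : ∀ k, 0 ≤ ((n.choose k : ℝ) * p ^ k * (1 - p) ^ (n - k)) := fun k => by positivity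
  rw [le_div_iff₀ (by positivity), Finset.sum_mul]
  calc _ ≤ ∑ k ∈ S, ((n:ℝ) * p - k)^2 * ((n.choose k : ℝ) * p ^ k * (1 - p) ^ (n - k)) := by
        apply Finset.sum_le_sum
        intro k hk
        rw [mul_comm]
        exact mul_le_mul_of_nonneg_right (hSa k hk) (hw k)
    _ ≤ _ := Finset.sum_le_sum_of_subset_of_nonneg hS
        (fun k _ _ => mul_nonneg (sq_nonneg _) (hw k))
    _ = n * p * (1 - p) := bt_variance n p
    _ ≤ n * p := by
        have : 0 ≤ (n:ℝ) * p * p := by positivity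
        linarith

theorem bt_upper (n : ℕ) (p a : ℝ) (c : ℕ) (hp : 0 ≤ p) (hp1 : p ≤ 1) (ha : 0 < a)
    (hc : n * p + a ≤ c) : binomTail n p c ≤ n * p / a^2 := by
  unfold binomTail
  apply bt_cheb n p a hp hp1 ha
  · intro k hk
    simp at hk ⊢
    omega
  · intro k hk
    have : (c:ℝ) ≤ k := by exact_mod_cast (Finset.mem_Icc.1 hk).1
    nlinarith

theorem bt_split (n : ℕ) (p : ℝ) (c : ℕ) :
    binomTail n p c + ∑ k ∈ (Finset.range (n+1)).filter (· < c),
      ((n.choose k : ℝ) * p ^ k * (1 - p) ^ (n - k)) = 1 := by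
  refine Eq.trans ?_ (bt_total n p)
  rw [← Finset.sum_filter_add_sum_filter_not (Finset.range (n+1)) (· < c), add_comm]
  congr 1
  unfold binomTail
  apply Finset.sum_congr _ (fun _ _ => rfl)
  ext k
  simp
  omega

theorem bt_lower (n : ℕ) (p a : ℝ) (c : ℕ) (hp : 0 ≤ p) (hp1 : p ≤ 1) (ha : 0 < a)
    (hc : c + a ≤ n * p) : 1 - n * p / a^2 ≤ binomTail n p c := by
  have h := bt_split n p c
  have := bt_cheb n p a hp hp1 ha ((Finset.range (n+1)).filter (· < c))
    (Finset.filter_subset _ _) (by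
      intro k hk
      have : (k:ℝ) ≤ c := by exact_mod_cast (Finset.mem_filter.1 hk).2.le
      nlinarith)
  linarith

theorem bt_le_one (n : ℕ) (p : ℝ) (c : ℕ) (hp : 0 ≤ p) (hp1 : p ≤ 1) :
    binomTail n p c ≤ 1 := by
  have h := bt_split n p c
  have hq : 0 ≤ 1 - p := by linarith
  have : 0 ≤ ∑ k ∈ (Finset.range (n+1)).filter (· < c),
      ((n.choose k : ℝ) * p ^ k * (1 - p) ^ (n - k)) :=
    Finset.sum_nonneg (fun k _ => by positivity)
  linarith

theorem bt_key (n : ℕ) (p q α d : ℝ) (hp : 0 < p) (hp1 : p ≤ 1) (hq1 : q ≤ 1) (hn : 0 < n)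
    (hα : 0 < α) (hd : 4 ≤ d) (hdq : n * p + d ≤ n * q)
    (hda : n * p / α ≤ (d/4)^2) :
    1 - 4 * (n * p / d^2 + 1 / d) ≤ binomTail n q (critVal n p α) := by
  have hn' : (0:ℝ) < n := by exact_mod_cast hn
  have hA : 0 < n * p := by positivity
  have hr : 0 < Real.sqrt (n * p / α) := Real.sqrt_pos.2 (by positivity)
  have hcv : critVal n p α ≤ ⌈n * p + Real.sqrt (n * p / α)⌉₊ := by
    apply Nat.sInf_le
    refine (bt_upper n p _ _ hp.le hp1 hr (Nat.le_ceil _)).trans ?_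
    rw [Real.sq_sqrt (by positivity)]
    field_simp
    exact le_rfl
  have hcv' : (critVal n p α : ℝ) ≤ n * p + Real.sqrt (n * p / α) + 1 :=
    (Nat.cast_le.2 hcv).trans (Nat.ceil_lt_add_one (by positivity)).le
  have hs : Real.sqrt (n * p / α) ≤ d / 4 := by
    rw [Real.sqrt_le_left (by linarith)]
    exact hda
  set D := (n:ℝ) * q - n * p with hD
  have hDd : d ≤ D := by linarith
  have hd0 : 0 < d := by linarith
  have hD0 : 0 < D := by linarith
  have hq0 : 0 ≤ q := by
    by_contra h
    nlinarith
  refine le_trans ?_ (bt_lower n q (D/2) _ hq0 hq1 (by positivity) (by linarith))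
  have e : n * q / (D/2)^2 = 4 * (n * p / D^2 + 1 / D) := by
    have : (n:ℝ) * q = n * p + D := by linarith
    rw [this]
    field_simp
    norm_num
  rw [e]
  gcongr

/-- Sufficient condition for the oracle threshold test to be asymptotically powerful. -/
theorem oracle_threshold_test_powerful
    (F : ℝ → ℝ) (hFcont : Continuous F) (hFmono : Monotone F)
    (hFbot : Tendsto F atBot (nhds 0)) (hFtop : Tendsto F atTop (nhds 1))
    (ε : ℕ → ℝ) (hε : ∀ n, ε n ∈ Set.Ioc (0 : ℝ) (1 / 2))
    (μ : ℕ → ℝ) (hμ : ∀ n, 0 ≤ μ n)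
    (hreg1 : Tendsto (fun n : ℕ => n * ε n) atTop atTop)
    (hreg2 : Tendsto (fun n : ℕ => Real.sqrt n * ε n) atTop (nhds 0))
    (t : ℕ → ℝ) (ht : ∀ n, 0 < 1 - F (t n))
    (h1 : Tendsto (fun n : ℕ => n * ε n * (1 - F (t n - μ n))) atTop atTop)
    (h2 : Tendsto (fun n : ℕ => n * ε n ^ 2 * (1 - F (t n - μ n)) ^ 2 / (1 - F (t n)))
      atTop atTop)
    (α : ℝ) (hα : α ∈ Set.Ioo (0 : ℝ) 1) :
    Tendsto (fun n : ℕ =>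
        binomTail n ((1 - ε n) * (1 - F (t n)) + ε n * (1 - F (t n - μ n)))
          (critVal n (1 - F (t n)) α))
      atTop (nhds 1) := by
  have hF1 : ∀ x, F x ≤ 1 := fun x => hFmono.ge_of_tendsto hFtop x
  have hF0 : ∀ x, 0 ≤ F x := fun x => hFmono.le_of_tendsto hFbot x
  set p : ℕ → ℝ := fun n => 1 - F (t n) with hp
  set s : ℕ → ℝ := fun n => 1 - F (t n - μ n) with hs
  have hps : ∀ n, p n ≤ s n := fun n => by
    have := hFmono (show t n - μ n ≤ t n by linarith [hμ n])
    simp only [hp, hs]; linarith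
  have hs1 : ∀ n, s n ≤ 1 := fun n => by simp only [hs]; linarith [hF0 (t n - μ n)]
  have hp0 : ∀ n, 0 < p n := ht
  change Tendsto (fun n : ℕ => n * ε n * s n) atTop atTop at h1
  change Tendsto (fun n : ℕ => n * ε n ^ 2 * s n ^ 2 / p n) atTop atTop at h2
  change Tendsto (fun n : ℕ => binomTail n ((1 - ε n) * p n + ε n * s n) (critVal n (p n) α))
      atTop (nhds 1)
  have hq1 : ∀ n, (1 - ε n) * p n + ε n * s n ≤ 1 := fun n => by
    have := (hε n).1
    have := (hε n).2
    nlinarith [hps n, hs1 n]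
  have hq0 : ∀ n, 0 ≤ (1 - ε n) * p n + ε n * s n := fun n => by
    have := (hε n).1
    have := (hε n).2
    nlinarith [hps n, hp0 n]
  have hd : Tendsto (fun n : ℕ => n * ε n * s n / 2) atTop atTop :=
    h1.atTop_div_const (by norm_num)
  have hlim : Tendsto (fun n : ℕ => 1 - 4 * (4 * (n * ε n ^ 2 * s n ^ 2 / p n)⁻¹
      + (n * ε n * s n / 2)⁻¹)) atTop (nhds 1) := by
    have := ((h2.inv_tendsto_atTop.const_mul 4).add hd.inv_tendsto_atTop).const_mul 4
    simpa using this.const_sub 1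
  refine tendsto_of_tendsto_of_tendsto_of_le_of_le' hlim tendsto_const_nhds ?_
    (Eventually.of_forall fun n => bt_le_one n _ _ (hq0 n) (hq1 n))
  filter_upwards [hd.eventually_ge_atTop 4, h2.eventually_ge_atTop (64 / α),
    h2.eventually_ge_atTop 2, hreg2.eventually_le_const (show (0:ℝ) < 1 by norm_num),
    eventually_gt_atTop 0] with n a1 a2 a3 a4 a5
  have hn : (0:ℝ) < n := by exact_mod_cast a5
  have he := (hε n).1
  have hpn := hp0 n
  have hsn : 0 < s n := hpn.trans_le (hps n)
  have hαp := hα.1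
  have hne : n * ε n ^ 2 ≤ 1 := by
    have : (Real.sqrt n * ε n)^2 ≤ 1 := by
      have : 0 ≤ Real.sqrt n * ε n := by positivity
      nlinarith
    rwa [mul_pow, Real.sq_sqrt hn.le] at this
  have h2p : 2 * p n ≤ s n := by
    rw [le_div_iff₀ hpn] at a3
    have : n * ε n ^ 2 * s n ^ 2 ≤ 1 * s n ^ 2 := by gcongr
    nlinarith [hs1 n]
  refine le_trans (le_of_eq ?_) (bt_key n (p n) _ α (n * ε n * s n / 2) hpn
    ((hps n).trans (hs1 n)) (hq1 n) a5 hαp a1 ?_ ?_)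
  · field_simp
    ring
  · have : 0 ≤ (n * ε n) * (s n - 2 * p n) := mul_nonneg (by positivity) (by linarith)
    nlinarith
  · rw [div_le_div_iff₀ hαp hpn] at a2
    rw [div_le_iff₀ hαp]
    have := mul_le_mul_of_nonneg_left a2 hn.le
    nlinarith
end

section
/- Assume the asymptotic regime nε_n → ∞ and √n·ε_n → 0, and that F̄(t) > 0 for all t∈ℝ. If (t_n) is any sequence of thresholds such that nε_n² F̄(t_n − μ_n)²/F̄(t_n) → 0, then P(Binomial(n, q_{t_n}(μ_n)) ≥ c_{t_n}) − P(Binomial(n, F̄(t_n)) ≥ c_{t_n}) → 0 for the level-α critical values c_{t_n}; that is, every such sequence of threshold tests is asymptotically powerless. -/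
open Filter

lemma binom_tail_diff (n : ℕ) (p q : ℝ) (c : ℕ) (hp0 : 0 < p) (hp1 : p < 1) :
    (binomTail n q c - binomTail n p c) ^ 2
      ≤ Real.exp (n * ((q - p) ^ 2 / (p * (1 - p)))) - 1 := by
  have hp1' : 0 < 1 - p := by linarith
  set f : ℝ → ℕ → ℝ := fun r k => (n.choose k : ℝ) * r ^ k * (1 - r) ^ (n - k) with hf
  have hsum : ∀ r, ∑ k ∈ Finset.range (n + 1), f r k = 1 := by
    intro r
    have := add_pow r (1 - r) n
    rw [add_sub_cancel, one_pow] at this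
    rw [this]
    refine Finset.sum_congr rfl fun k _ => ?_
    simp only [hf]; ring
  have hpos : ∀ k ∈ Finset.range (n + 1), 0 < f p k := by
    intro k hk
    have hk' : k ≤ n := by simpa [Nat.lt_succ_iff] using hk
    have : (0 : ℝ) < n.choose k := by exact_mod_cast Nat.choose_pos hk'
    simp only [hf]; positivity
  have hsub : Finset.Icc c n ⊆ Finset.range (n + 1) := by
    intro k hk
    simp at hk ⊢; omega
  have hsq : ∑ k ∈ Finset.range (n + 1), f q k ^ 2 / f p k
      = (1 + (q - p) ^ 2 / (p * (1 - p))) ^ n := by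
    have e : 1 + (q - p) ^ 2 / (p * (1 - p)) = q ^ 2 / p + (1 - q) ^ 2 / (1 - p) := by
      field_simp; ring
    rw [e, add_pow]
    refine Finset.sum_congr rfl fun k hk => ?_
    have hk' : k ≤ n := by simpa [Nat.lt_succ_iff] using hk
    have hc : (0 : ℝ) < n.choose k := by exact_mod_cast Nat.choose_pos hk'
    simp only [hf, div_pow]
    have h1 : 0 < p ^ k := by positivity
    have h2 : 0 < (1 - p) ^ (n - k) := by positivity
    rw [← pow_mul, ← pow_mul, mul_comm 2 k, mul_comm 2 (n - k), pow_mul, pow_mul]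
    field_simp
  have hchi : ∑ k ∈ Finset.range (n + 1), (f q k - f p k) ^ 2 / f p k
      = (1 + (q - p) ^ 2 / (p * (1 - p))) ^ n - 1 := by
    have : ∑ k ∈ Finset.range (n + 1), (f q k - f p k) ^ 2 / f p k
        = ∑ k ∈ Finset.range (n + 1), (f q k ^ 2 / f p k - 2 * f q k + f p k) := by
      refine Finset.sum_congr rfl fun k hk => ?_
      have := hpos k hk
      field_simp; ring
    rw [this, Finset.sum_add_distrib, Finset.sum_sub_distrib, ← Finset.mul_sum, hsum, hsum, hsq]
    ring
  have hcs : (∑ k ∈ Finset.Icc c n, (f q k - f p k)) ^ 2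
      ≤ (∑ k ∈ Finset.Icc c n, f p k) *
        ∑ k ∈ Finset.Icc c n, (f q k - f p k) ^ 2 / f p k := by
    refine Finset.sum_sq_le_sum_mul_sum_of_sq_le_mul _ (fun k hk => (hpos k (hsub hk)).le)
      (fun k hk => ?_) (fun k hk => ?_)
    · have := hpos k (hsub hk); positivity
    · have := hpos k (hsub hk); apply le_of_eq; field_simp
  have hA : ∑ k ∈ Finset.Icc c n, f p k ≤ 1 := by
    rw [← hsum p]
    exact Finset.sum_le_sum_of_subset_of_nonneg hsub fun k hk _ => (hpos k hk).le
  have hB : ∑ k ∈ Finset.Icc c n, (f q k - f p k) ^ 2 / f p k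
      ≤ ∑ k ∈ Finset.range (n + 1), (f q k - f p k) ^ 2 / f p k := by
    refine Finset.sum_le_sum_of_subset_of_nonneg hsub fun k hk _ => ?_
    have := hpos k hk; positivity
  have hB0 : 0 ≤ ∑ k ∈ Finset.Icc c n, (f q k - f p k) ^ 2 / f p k := by
    refine Finset.sum_nonneg fun k hk => ?_
    have := hpos k (hsub hk); positivity
  have hx : 0 ≤ (q - p) ^ 2 / (p * (1 - p)) := by positivity
  have hexp : (1 + (q - p) ^ 2 / (p * (1 - p))) ^ n
      ≤ Real.exp (n * ((q - p) ^ 2 / (p * (1 - p)))) := by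
    rw [Real.exp_nat_mul]
    refine pow_le_pow_left₀ (by positivity) ?_ n
    rw [add_comm]; exact Real.add_one_le_exp _
  have heq : binomTail n q c - binomTail n p c = ∑ k ∈ Finset.Icc c n, (f q k - f p k) := by
    rw [Finset.sum_sub_distrib]; rfl
  rw [heq]
  have := mul_le_of_le_one_left hB0 hA
  linarith

/-- Condition under which every sequence of threshold tests is asymptotically powerless. -/
theorem threshold_test_powerless
    (F : ℝ → ℝ) (hFcont : Continuous F) (hFmono : Monotone F)
    (hFbot : Tendsto F atBot (nhds 0)) (hFtop : Tendsto F atTop (nhds 1))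
    (hFbar : ∀ t, 0 < 1 - F t)
    (ε : ℕ → ℝ) (hε : ∀ n, ε n ∈ Set.Ioc (0 : ℝ) (1 / 2))
    (μ : ℕ → ℝ) (hμ : ∀ n, 0 ≤ μ n)
    (hreg1 : Tendsto (fun n : ℕ => n * ε n) atTop atTop)
    (hreg2 : Tendsto (fun n : ℕ => Real.sqrt n * ε n) atTop (nhds 0))
    (t : ℕ → ℝ)
    (h : Tendsto (fun n : ℕ => n * ε n ^ 2 * (1 - F (t n - μ n)) ^ 2 / (1 - F (t n)))
      atTop (nhds 0))
    (α : ℝ) (hα : α ∈ Set.Ioo (0 : ℝ) 1) :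
    Tendsto (fun n : ℕ =>
        binomTail n ((1 - ε n) * (1 - F (t n)) + ε n * (1 - F (t n - μ n)))
          (critVal n (1 - F (t n)) α)
        - binomTail n (1 - F (t n)) (critVal n (1 - F (t n)) α))
      atTop (nhds 0) := by
  have hF0 : ∀ x, 0 ≤ F x := fun x => hFmono.le_of_tendsto hFbot x
  have key : ∀ n : ℕ, (binomTail n ((1 - ε n) * (1 - F (t n)) + ε n * (1 - F (t n - μ n)))
          (critVal n (1 - F (t n)) α)
        - binomTail n (1 - F (t n)) (critVal n (1 - F (t n)) α)) ^ 2
      ≤ Real.exp (n * ε n ^ 2 * (1 - F (t n - μ n)) ^ 2 / (1 - F (t n))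
          + (Real.sqrt n * ε n) ^ 2) - 1 := by
    intro n
    have hp0 := hFbar (t n)
    have hm : F (t n - μ n) ≤ F (t n) := hFmono (by linarith [hμ n])
    have hr0 := hF0 (t n - μ n)
    generalize critVal n (1 - F (t n)) α = c
    generalize ha : F (t n) = a at *
    generalize hb : F (t n - μ n) = b at *
    generalize ε n = e
    rw [mul_pow, Real.sq_sqrt (Nat.cast_nonneg n)]
    rcases (hr0.trans hm).eq_or_lt with h0 | h0
    · have hb0 : b = 0 := by linarith
      subst hb0
      rw [← h0]
      have : (1 - e) * (1 - 0) + e * (1 - 0) = (1 - 0 : ℝ) := by ring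
      rw [this, sub_self]
      have : (0 : ℝ) ≤ n * e ^ 2 * (1 - 0) ^ 2 / (1 - 0) + n * e ^ 2 := by positivity
      have := Real.one_le_exp this
      linarith
    · refine (binom_tail_diff n (1 - a) _ c hp0 (by linarith)).trans ?_
      refine sub_le_sub_right (Real.exp_le_exp.2 ?_) 1
      have e1 : (n : ℝ) * (((1 - e) * (1 - a) + e * (1 - b) - (1 - a)) ^ 2
          / ((1 - a) * (1 - (1 - a))))
          = n * e ^ 2 * (a - b) ^ 2 / (1 - a) + n * e ^ 2 * ((a - b) ^ 2 / a) := by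
        rw [sub_sub_cancel]
        field_simp
        ring
      rw [e1]
      have h1 : (a - b) ^ 2 ≤ (1 - b) ^ 2 := by
        apply pow_le_pow_left₀ <;> linarith
      have h2 : (a - b) ^ 2 / a ≤ 1 := by
        rw [div_le_one h0]; nlinarith
      have h3 : (n : ℝ) * e ^ 2 * ((a - b) ^ 2 / a) ≤ n * e ^ 2 :=
        mul_le_of_le_one_right (by positivity) h2
      refine add_le_add ?_ h3
      gcongr
  have hlim : Tendsto (fun n : ℕ => Real.exp (n * ε n ^ 2 * (1 - F (t n - μ n)) ^ 2 / (1 - F (t n))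
          + (Real.sqrt n * ε n) ^ 2) - 1) atTop (nhds 0) := by
    have h1 := h.add (hreg2.pow 2)
    have h2 := ((Real.continuous_exp.tendsto _).comp h1).sub_const 1
    simpa [Function.comp_def] using h2
  have hsq := squeeze_zero (fun n => sq_nonneg _) key hlim
  have h3 := (Real.continuous_sqrt.tendsto _).comp hsq
  simp only [Function.comp_def, Real.sqrt_sq_eq_abs, Real.sqrt_zero] at h3
  exact (tendsto_zero_iff_abs_tendsto_zero _).2 h3
end

section
/- Assume the asymptotic regime nε_n → ∞ and √n·ε_n → 0. Suppose there is a sequence of intervals [s_n, t_n] (s_n ≤ t_n) with F[s_n,t_n] > 0 such that nε_n F[s_n−μ_n, t_n−μ_n] → ∞ and nε_n² F[s_n−μ_n, t_n−μ_n]²/F[s_n,t_n] → ∞. Then for every level α∈(0,1), P(Binomial(n, q_{s_n,t_n}(μ_n)) ≥ c_{s_n,t_n}) → 1, where c_{s_n,t_n} is the level-α critical value computed from Binomial(n, F[s_n,t_n]); that is, the oracle scan test is asymptotically powerful. -/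
open Filter

lemma btail_sum (n : ℕ) (p : ℝ) :
    ∑ k ∈ Finset.range (n+1), (n.choose k : ℝ) * p ^ k * (1 - p) ^ (n - k) = 1 := by
  have h := congrArg (Polynomial.eval p) (bernsteinPolynomial.sum ℝ n)
  simpa [Polynomial.eval_finsetSum, bernsteinPolynomial] using h

lemma btail_var (n : ℕ) (p : ℝ) :
    ∑ k ∈ Finset.range (n+1), (n * p - k)^2 * ((n.choose k : ℝ) * p ^ k * (1 - p) ^ (n - k))
      = n * p * (1 - p) := by
  have h := congrArg (Polynomial.eval p) (bernsteinPolynomial.variance ℝ n)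
  simpa [Polynomial.eval_finsetSum, bernsteinPolynomial] using h

lemma bterm_nonneg (n k : ℕ) (p : ℝ) (h0 : 0 ≤ p) (h1 : p ≤ 1) :
    0 ≤ (n.choose k : ℝ) * p ^ k * (1 - p) ^ (n - k) := by
  have : 0 ≤ 1 - p := by linarith
  positivity

lemma btail_cheb (n : ℕ) (p d : ℝ) (h0 : 0 ≤ p) (h1 : p ≤ 1) (hd : 0 < d) (S : Finset ℕ)
    (hS : S ⊆ Finset.range (n+1)) (hSd : ∀ k ∈ S, d^2 ≤ (n * p - k)^2) :
    ∑ k ∈ S, (n.choose k : ℝ) * p ^ k * (1 - p) ^ (n - k) ≤ n * p / d^2 := by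
  rw [le_div_iff₀ (by positivity), Finset.sum_mul]
  calc _ ≤ ∑ k ∈ S, (n * p - k)^2 * ((n.choose k : ℝ) * p ^ k * (1 - p) ^ (n - k)) := by
        refine Finset.sum_le_sum fun k hk => ?_
        rw [mul_comm]
        exact mul_le_mul_of_nonneg_right (hSd k hk) (bterm_nonneg n k p h0 h1)
    _ ≤ ∑ k ∈ Finset.range (n+1),
          (n * p - k)^2 * ((n.choose k : ℝ) * p ^ k * (1 - p) ^ (n - k)) :=
        Finset.sum_le_sum_of_subset_of_nonneg hS fun k _ _ =>
          mul_nonneg (sq_nonneg _) (bterm_nonneg n k p h0 h1)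
    _ = n * p * (1 - p) := btail_var n p
    _ ≤ n * p := by
        have : 0 ≤ n * p := by positivity
        nlinarith

lemma btail_le_one (n : ℕ) (p : ℝ) (c : ℕ) (h0 : 0 ≤ p) (h1 : p ≤ 1) : binomTail n p c ≤ 1 := by
  rw [← btail_sum n p]
  refine Finset.sum_le_sum_of_subset_of_nonneg ?_ fun k _ _ => bterm_nonneg n k p h0 h1
  intro k hk
  simp at hk ⊢
  omega

lemma btail_anti (n : ℕ) (p : ℝ) (c d : ℕ) (h0 : 0 ≤ p) (h1 : p ≤ 1) (h : c ≤ d) :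
    binomTail n p d ≤ binomTail n p c :=
  Finset.sum_le_sum_of_subset_of_nonneg (Finset.Icc_subset_Icc_left h)
    fun k _ _ => bterm_nonneg n k p h0 h1

lemma btail_lower (n : ℕ) (p : ℝ) (c : ℕ) (d : ℝ) (h0 : 0 ≤ p) (h1 : p ≤ 1) (hd : 0 < d)
    (hk : ∀ k : ℕ, k < c → (k : ℝ) + d ≤ n * p) : 1 - n * p / d^2 ≤ binomTail n p c := by
  have hc := btail_cheb n p d h0 h1 hd ((Finset.range (n+1)).filter (· < c))
    (Finset.filter_subset _ _) (by
      intro k hk'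
      have := hk k (Finset.mem_filter.1 hk').2
      exact pow_le_pow_left₀ hd.le (by linarith) 2)
  have hs := Finset.sum_filter_add_sum_filter_not (Finset.range (n+1)) (· < c)
    (fun k => (n.choose k : ℝ) * p ^ k * (1 - p) ^ (n - k))
  rw [btail_sum] at hs
  have he : (Finset.range (n+1)).filter (fun k => ¬ k < c) = Finset.Icc c n := by
    ext k
    simp
    omega
  rw [he] at hs
  unfold binomTail
  linarith

lemma btail_upper (n : ℕ) (p : ℝ) (c : ℕ) (d : ℝ) (h0 : 0 ≤ p) (h1 : p ≤ 1) (hd : 0 < d)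
    (hk : n * p + d ≤ c) : binomTail n p c ≤ n * p / d^2 := by
  refine btail_cheb n p d h0 h1 hd _ ?_ ?_
  · intro k hk
    simp at hk ⊢
    omega
  · intro k hk'
    have : (c : ℝ) ≤ k := by exact_mod_cast (Finset.mem_Icc.1 hk').1
    have h2 : d ≤ k - n * p := by linarith
    calc d^2 ≤ (k - n * p)^2 := pow_le_pow_left₀ hd.le h2 2
      _ = _ := by ring

lemma power_bound (n : ℕ) (p r e α : ℝ) (hp : 0 < p) (hp1 : p ≤ 1) (hr : 0 ≤ r) (hr1 : r ≤ 1)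
    (he : 0 < e) (he1 : e ≤ 1/2) (hA : 0 < n * e * r) (hpr : p ≤ r / 2)
    (hB : 16 / (n * e^2 * r^2 / p) ≤ α) :
    1 - (16 / (n * e^2 * r^2 / p) + 16 / (n * e * r)) ≤
      binomTail n ((1 - e) * p + e * r) (critVal n p α) ∧
      binomTail n ((1 - e) * p + e * r) (critVal n p α) ≤ 1 := by
  have hn : (0 : ℝ) < n := by
    rcases Nat.eq_zero_or_pos n with h | h
    · simp [h] at hA
    · exact_mod_cast h
  have hr0 : 0 < r := by linarith
  have hq0 : 0 ≤ (1 - e) * p + e * r := by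
    have : 0 ≤ 1 - e := by linarith
    positivity
  have hq1 : (1 - e) * p + e * r ≤ 1 := by nlinarith
  refine ⟨?_, btail_le_one _ _ _ hq0 hq1⟩
  set A := n * e * r with hAdef
  have key : (n : ℝ) * p / (A/4)^2 = 16 / (n * e^2 * r^2 / p) := by
    rw [hAdef]; field_simp; norm_num
  have hc : critVal n p α ≤ ⌈n * p + A / 4⌉₊ := by
    apply Nat.sInf_le
    refine (btail_upper n p _ (A/4) hp.le hp1 (by positivity) (Nat.le_ceil _)).trans ?_
    rw [key]; exact hB
  refine le_trans ?_ (btail_anti n _ _ _ hq0 hq1 hc)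
  have hmean : n * p + A / 2 ≤ n * ((1 - e) * p + e * r) := by
    have := mul_le_mul_of_nonneg_left hpr (mul_pos hn he).le
    rw [hAdef]; linarith
  refine le_trans ?_ (btail_lower n _ _ (A/4) hq0 hq1 (by positivity) ?_)
  · have h3 : n * ((1 - e) * p + e * r) / (A/4)^2 ≤ (n * p + A) / (A/4)^2 := by
      gcongr
      have : 0 ≤ n * (e * p) := by positivity
      rw [hAdef]; linarith
    have h4 : (n * p + A) / (A/4)^2 = 16 / (n * e^2 * r^2 / p) + 16 / A := by
      rw [add_div, key]; congr 1; field_simp; norm_num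
    linarith
  · intro k hk
    have := Nat.lt_ceil.1 hk
    linarith

/-- Sufficient condition for the oracle scan test to be asymptotically powerful. -/
theorem oracle_scan_test_powerful
    (F : ℝ → ℝ) (hFcont : Continuous F) (hFmono : Monotone F)
    (hFbot : Tendsto F atBot (nhds 0)) (hFtop : Tendsto F atTop (nhds 1))
    (ε : ℕ → ℝ) (hε : ∀ n, ε n ∈ Set.Ioc (0 : ℝ) (1 / 2))
    (μ : ℕ → ℝ) (hμ : ∀ n, 0 ≤ μ n)
    (hreg1 : Tendsto (fun n : ℕ => n * ε n) atTop atTop)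
    (hreg2 : Tendsto (fun n : ℕ => Real.sqrt n * ε n) atTop (nhds 0))
    (s t : ℕ → ℝ) (hst : ∀ n, s n ≤ t n) (hpos : ∀ n, 0 < F (t n) - F (s n))
    (h1 : Tendsto (fun n : ℕ => n * ε n * (F (t n - μ n) - F (s n - μ n))) atTop atTop)
    (h2 : Tendsto (fun n : ℕ =>
        n * ε n ^ 2 * (F (t n - μ n) - F (s n - μ n)) ^ 2 / (F (t n) - F (s n)))
      atTop atTop)
    (α : ℝ) (hα : α ∈ Set.Ioo (0 : ℝ) 1) :
    Tendsto (fun n : ℕ =>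
        binomTail n ((1 - ε n) * (F (t n) - F (s n)) + ε n * (F (t n - μ n) - F (s n - μ n)))
          (critVal n (F (t n) - F (s n)) α))
      atTop (nhds 1) := by
  have hF0 : ∀ x, 0 ≤ F x := fun x => hFmono.le_of_tendsto hFbot x
  have hF1 : ∀ x, F x ≤ 1 := fun x => hFmono.ge_of_tendsto hFtop x
  have hne : Tendsto (fun n : ℕ => (n : ℝ) * ε n ^ 2) atTop (nhds 0) := by
    have := hreg2.pow 2
    simp only [mul_pow, Real.sq_sqrt (Nat.cast_nonneg _)] at this
    simpa using this
  have l2 := (tendsto_const_nhds (x := (16 : ℝ))).div_atTop h2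
  have l1 := (tendsto_const_nhds (x := (16 : ℝ))).div_atTop h1
  have hlow : Tendsto (fun n : ℕ => 1 -
      (16 / (n * ε n ^ 2 * (F (t n - μ n) - F (s n - μ n)) ^ 2 / (F (t n) - F (s n)))
        + 16 / (n * ε n * (F (t n - μ n) - F (s n - μ n))))) atTop (nhds 1) := by
    simpa using (tendsto_const_nhds (x := (1 : ℝ))).sub (l2.add l1)
  have hev : ∀ᶠ n : ℕ in atTop, 1 -
      (16 / (n * ε n ^ 2 * (F (t n - μ n) - F (s n - μ n)) ^ 2 / (F (t n) - F (s n)))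
        + 16 / (n * ε n * (F (t n - μ n) - F (s n - μ n)))) ≤
        binomTail n ((1 - ε n) * (F (t n) - F (s n)) + ε n * (F (t n - μ n) - F (s n - μ n)))
          (critVal n (F (t n) - F (s n)) α) ∧
        binomTail n ((1 - ε n) * (F (t n) - F (s n)) + ε n * (F (t n - μ n) - F (s n - μ n)))
          (critVal n (F (t n) - F (s n)) α) ≤ 1 := by
    filter_upwards [h1.eventually_gt_atTop 0, h2.eventually_ge_atTop 2,
      l2.eventually_le_const hα.1, hne.eventually_le_const one_pos] with n ha hb hc hd
    have hr : 0 ≤ F (t n - μ n) - F (s n - μ n) :=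
      sub_nonneg.2 (hFmono (by linarith [hst n]))
    have hr1 : F (t n - μ n) - F (s n - μ n) ≤ 1 := by
      linarith [hF0 (s n - μ n), hF1 (t n - μ n)]
    have hp1 : F (t n) - F (s n) ≤ 1 := by linarith [hF0 (s n), hF1 (t n)]
    refine power_bound n _ _ _ α (hpos n) hp1 hr hr1 (hε n).1 (hε n).2 ha ?_ hc
    rw [le_div_iff₀ (hpos n)] at hb
    have h5 := mul_le_mul_of_nonneg_right hd (sq_nonneg (F (t n - μ n) - F (s n - μ n)))
    nlinarith
  exact tendsto_of_tendsto_of_tendsto_of_le_of_le' hlow tendsto_const_nhds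
    (hev.mono fun _ h => h.1) (hev.mono fun _ h => h.2)
end

section
/- Power-law model, achievability for the oracle threshold test: assume F̄(t) > 0 for all t and F̄(t) = C t^{−a}(log t)^{b}(1 + o(1)) as t → ∞, for constants C > 0, a > 0, b ∈ ℝ. Let 1/2 < β < 1, ε_n ∈ (0,1/2] with n^β ε_n → 1, and μ_n → ∞ with (a+1)log μ_n ∼ r log n for a fixed r > (1 + 1/a)(2β − 1). Then for every level α ∈ (0,1), the power of the oracle threshold test tends to 1: sup_{t∈ℝ} P(Binomial(n, q_t(μ_n)) ≥ c_t) → 1. -/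
open Filter

lemma binom_sum_one (n : ℕ) (p : ℝ) :
    ∑ k ∈ Finset.range (n + 1), (n.choose k : ℝ) * p ^ k * (1 - p) ^ (n - k) = 1 := by
  have h := add_pow p (1 - p) n
  rw [add_sub_cancel, one_pow] at h
  refine Eq.trans (Finset.sum_congr rfl fun k _ => ?_) h.symm
  ring

lemma binom_var (n : ℕ) (p : ℝ) :
    ∑ k ∈ Finset.range (n + 1), ((n : ℝ) * p - k) ^ 2 *
      ((n.choose k : ℝ) * p ^ k * (1 - p) ^ (n - k)) = n * p * (1 - p) := by
  have h := congrArg (Polynomial.eval p) (bernsteinPolynomial.variance ℝ n)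
  simpa [bernsteinPolynomial, Polynomial.eval_finset_sum] using h

lemma binom_cheb (n : ℕ) (p d : ℝ) (hp0 : 0 ≤ p) (hp1 : p ≤ 1) (hd : 0 < d)
    (S : Finset ℕ) (hS : S ⊆ Finset.range (n + 1))
    (hSd : ∀ k ∈ S, d ^ 2 ≤ ((n : ℝ) * p - k) ^ 2) :
    ∑ k ∈ S, (n.choose k : ℝ) * p ^ k * (1 - p) ^ (n - k) ≤ n * p / d ^ 2 := by
  have h1 : 0 ≤ 1 - p := by linarith
  rw [le_div_iff₀ (by positivity), Finset.sum_mul]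
  calc ∑ k ∈ S, (n.choose k : ℝ) * p ^ k * (1 - p) ^ (n - k) * d ^ 2
      ≤ ∑ k ∈ S, ((n : ℝ) * p - k) ^ 2 *
        ((n.choose k : ℝ) * p ^ k * (1 - p) ^ (n - k)) := by
        refine Finset.sum_le_sum fun k hk => ?_
        rw [mul_comm]
        exact mul_le_mul_of_nonneg_right (hSd k hk) (by positivity)
    _ ≤ ∑ k ∈ Finset.range (n + 1), ((n : ℝ) * p - k) ^ 2 *
        ((n.choose k : ℝ) * p ^ k * (1 - p) ^ (n - k)) :=
        Finset.sum_le_sum_of_subset_of_nonneg hS fun k _ _ => by positivity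
    _ = n * p * (1 - p) := binom_var n p
    _ ≤ n * p := by
        have : 0 ≤ (n : ℝ) * p := by positivity
        nlinarith

lemma binomTail_le_one (n : ℕ) (p : ℝ) (hp0 : 0 ≤ p) (hp1 : p ≤ 1) (c : ℕ) :
    binomTail n p c ≤ 1 := by
  have h1 : 0 ≤ 1 - p := by linarith
  rw [← binom_sum_one n p, binomTail]
  refine Finset.sum_le_sum_of_subset_of_nonneg ?_ fun k _ _ => by positivity
  intro k hk
  simp only [Finset.mem_Icc, Finset.mem_range] at *
  omega

lemma binomTail_ge (n : ℕ) (q d : ℝ) (hp0 : 0 ≤ q) (hp1 : q ≤ 1) (hd : 0 < d) (c : ℕ)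
    (hc : (c : ℝ) + d ≤ n * q) : 1 - n * q / d ^ 2 ≤ binomTail n q c := by
  have hcn : c ≤ n := by
    have : (n : ℝ) * q ≤ n := mul_le_of_le_one_right (by positivity) hp1
    have : (c : ℝ) ≤ n := by linarith
    exact_mod_cast this
  have hch := binom_cheb n q d hp0 hp1 hd (Finset.range c)
    (Finset.range_subset_range.2 (by omega)) (by
      intro k hk
      have : (k : ℝ) < c := by exact_mod_cast Finset.mem_range.1 hk
      apply pow_le_pow_left₀ hd.le
      linarith)
  have h1 := binom_sum_one n q
  rw [Finset.range_eq_Ico, ← Finset.sum_Ico_consecutive _ (Nat.zero_le c) (by omega : c ≤ n + 1)] at h1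
  have e : Finset.Ico c (n + 1) = Finset.Icc c n := by ext; simp [Nat.lt_succ_iff]
  rw [e, ← Finset.range_eq_Ico] at h1
  rw [binomTail]
  linarith

lemma critVal_le (n : ℕ) (p α d : ℝ) (hp0 : 0 ≤ p) (hp1 : p ≤ 1) (hd : 0 < d)
    (h : n * p / d ^ 2 ≤ α) : (critVal n p α : ℝ) ≤ n * p + d + 1 := by
  have h0 : 0 ≤ (n : ℝ) * p := by positivity
  have hle : critVal n p α ≤ ⌈(n : ℝ) * p + d⌉₊ := by
    apply Nat.sInf_le
    refine le_trans (binom_cheb n p d hp0 hp1 hd _ ?_ ?_) h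
    · intro k hk
      simp only [Finset.mem_Icc, Finset.mem_range] at *
      omega
    · intro k hk
      have h2 : (n : ℝ) * p + d ≤ k := Nat.ceil_le.1 (Finset.mem_Icc.1 hk).1
      rw [← neg_sq ((n : ℝ) * p - k)]
      apply pow_le_pow_left₀ hd.le
      linarith
  have := Nat.ceil_lt_add_one (show 0 ≤ (n : ℝ) * p + d by positivity)
  have h3 : (critVal n p α : ℝ) ≤ ⌈(n : ℝ) * p + d⌉₊ := by exact_mod_cast hle
  linarith

lemma power_lower (n : ℕ) (p q α D : ℝ) (hp0 : 0 ≤ p) (hp1 : p ≤ 1) (hq0 : 0 ≤ q) (hq1 : q ≤ 1)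
    (hD : 4 ≤ D) (hS : D ≤ n * q - n * p) (hα : n * p / D ^ 2 ≤ α / 16) :
    1 - 4 * (n * p / D ^ 2 + 1 / D) ≤ binomTail n q (critVal n p α) := by
  have hc := critVal_le n p α (D / 4) hp0 hp1 (by linarith) (by
    have : (n : ℝ) * p / (D / 4) ^ 2 = 16 * (n * p / D ^ 2) := by field_simp; norm_num
    linarith)
  set S := (n : ℝ) * q - n * p with hSdef
  have hSpos : 0 < S := by linarith
  have hDpos : 0 < D := by linarith
  have hnp : 0 ≤ (n : ℝ) * p := by positivity
  refine le_trans ?_ (binomTail_ge n q (S / 2) hq0 hq1 (by linarith) _ (by linarith))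
  have e : (n : ℝ) * q / (S / 2) ^ 2 = 4 * (n * p / S ^ 2 + 1 / S) := by
    have : (n : ℝ) * q = n * p + S := by rw [hSdef]; ring
    rw [this]; field_simp
    try ring
  rw [e]
  have : (n : ℝ) * p / S ^ 2 ≤ n * p / D ^ 2 := by gcongr
  have : 1 / S ≤ 1 / D := by gcongr
  linarith

lemma tail_bound (F : ℝ → ℝ) (C a b : ℝ) (hC : 0 < C) 
    (htail : Tendsto (fun t : ℝ => (1 - F t) / (C * t ^ (-a) * Real.log t ^ b))
      atTop (nhds 1)) (a' : ℝ) (ha' : a' < a) : ∀ᶠ t in atTop, 1 - F t ≤ t ^ (-a') := by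
  have hl := (isLittleO_log_rpow_rpow_atTop b (sub_pos.2 ha')).bound
    (show 0 < 1 / (2 * C) by positivity)
  have h2 := htail.eventually_lt_const (show (1 : ℝ) < 2 by norm_num)
  filter_upwards [hl, h2, eventually_gt_atTop 1] with t h1 h2 ht
  have ht0 : 0 < t := by linarith
  have hlog := Real.log_pos ht
  have hx : 0 < Real.log t ^ b := Real.rpow_pos_of_pos hlog b
  have hy : 0 < t ^ (-a) := Real.rpow_pos_of_pos ht0 _
  rw [div_lt_iff₀ (by positivity)] at h2
  rw [Real.norm_of_nonneg hx.le, Real.norm_of_nonneg (by positivity)] at h1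
  have e : t ^ (-a') = t ^ (-a) * t ^ (a - a') := by rw [← Real.rpow_add ht0]; congr 1; ring
  rw [e]
  calc 1 - F t ≤ 2 * C * t ^ (-a) * Real.log t ^ b := by linarith
    _ ≤ 2 * C * t ^ (-a) * (1 / (2 * C) * t ^ (a - a')) := by gcongr
    _ = _ := by field_simp

/-- In the power-law model `F̄(t) = C t^{-a} (log t)^b (1 + o(1))`, above the boundary
`r = (1 + 1/a)(2β - 1)` the oracle threshold test is asymptotically powerful. -/
theorem oracle_threshold_achieves_power_law_threshold_boundary
    (F : ℝ → ℝ) (hFcont : Continuous F) (hFmono : Monotone F)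
    (hFbot : Tendsto F atBot (nhds 0)) (hFtop : Tendsto F atTop (nhds 1))
    (hFbar : ∀ t, 0 < 1 - F t)
    (C a b : ℝ) (hC : 0 < C) (ha : 0 < a)
    (htail : Tendsto (fun t : ℝ => (1 - F t) / (C * t ^ (-a) * Real.log t ^ b))
      atTop (nhds 1))
    (β r : ℝ) (hβ : β ∈ Set.Ioo (1 / 2 : ℝ) 1) (hr : (1 + 1 / a) * (2 * β - 1) < r)
    (ε : ℕ → ℝ) (hε : ∀ n, ε n ∈ Set.Ioc (0 : ℝ) (1 / 2))
    (hεβ : Tendsto (fun n : ℕ => (n : ℝ) ^ β * ε n) atTop (nhds 1))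
    (μ : ℕ → ℝ) (hμtop : Tendsto μ atTop atTop)
    (hμr : Tendsto (fun n : ℕ => (a + 1) * Real.log (μ n) / (r * Real.log n))
      atTop (nhds 1))
    (α : ℝ) (hα : α ∈ Set.Ioo (0 : ℝ) 1) :
    Tendsto (fun n : ℕ =>
        ⨆ t : ℝ, binomTail n ((1 - ε n) * (1 - F t) + ε n * (1 - F (t - μ n)))
          (critVal n (1 - F t) α))
      atTop (nhds 1) := by
  obtain ⟨hβ1, hβ2⟩ := hβ
  obtain ⟨hα0, hα1⟩ := hα
  have hF0 : ∀ t, 0 ≤ F t := fun t => hFmono.le_of_tendsto hFbot t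
  have hL : 0 < 2 * β - 1 := by linarith
  have hr0 : 0 < r := lt_trans (by positivity) hr
  have hra : (2 * β - 1) / a < r / (a + 1) := by
    rw [div_lt_div_iff₀ ha (by linarith)]
    have : (1 + 1 / a) * (2 * β - 1) * a = (2 * β - 1) * (a + 1) := by field_simp
    rw [← this]
    exact mul_lt_mul_of_pos_right hr ha
  obtain ⟨ρ, hρ1, hρ2⟩ := exists_between hra
  have hρ0 : 0 < ρ := lt_trans (by positivity) hρ1
  have hLa : (2 * β - 1) / ρ < a := by
    rw [div_lt_iff₀ ha] at hρ1
    rw [div_lt_iff₀ hρ0]; linarith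
  obtain ⟨a', ha1, ha2⟩ := exists_between hLa
  have ha0 : 0 < a' := lt_trans (by positivity) ha1
  have hκ : 0 < a' * ρ - (2 * β - 1) := by
    rw [div_lt_iff₀ hρ0] at ha1; linarith
  have hncast : Tendsto (fun n : ℕ => (n : ℝ)) atTop atTop := tendsto_natCast_atTop_atTop
  -- lower bound on μ
  have hμlow : ∀ᶠ n : ℕ in atTop, (n : ℝ) ^ ρ ≤ μ n := by
    have hlt : ρ * (a + 1) / r < 1 := by
      rw [div_lt_one hr0]; rwa [lt_div_iff₀ (by linarith)] at hρ2
    filter_upwards [hμr.eventually_const_lt hlt, hμtop.eventually_gt_atTop 0,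
      hncast.eventually_gt_atTop 1] with n h1 h2 h3
    have hlog := Real.log_pos h3
    rw [div_lt_div_iff₀ hr0 (by positivity)] at h1
    have h4 : ρ * Real.log n ≤ Real.log (μ n) := by
      have : 0 < (a + 1) * r := by positivity
      by_contra hcon
      push Not at hcon
      nlinarith [mul_lt_mul_of_pos_left hcon this]
    rw [← Real.exp_log h2, Real.rpow_def_of_pos (by linarith), Real.exp_le_exp]
    linarith
  have hp : ∀ᶠ n : ℕ in atTop, 1 - F (μ n) ≤ (n : ℝ) ^ (-(a' * ρ)) := by
    filter_upwards [hμlow, hμtop.eventually (tail_bound F C a b hC htail a' ha2),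
      hncast.eventually_gt_atTop 1] with n h1 h2 h3
    refine h2.trans ?_
    have hn0 : (0 : ℝ) < n := by linarith
    calc μ n ^ (-a') ≤ ((n : ℝ) ^ ρ) ^ (-a') :=
          Real.rpow_le_rpow_of_nonpos (Real.rpow_pos_of_pos hn0 _) h1 (by linarith)
      _ = _ := by rw [← Real.rpow_mul hn0.le]; congr 1; ring
  set G := 1 - F 0 with hG
  have hGpos : 0 < G := hFbar 0
  let D : ℕ → ℝ := fun n => n * ε n * G / 2
  have hDtop : Tendsto D atTop atTop := by
    have h1 : Tendsto (fun n : ℕ => (n : ℝ) ^ (1 - β)) atTop atTop :=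
      (tendsto_rpow_atTop (by linarith)).comp hncast
    have h2 := (h1.atTop_mul_pos one_pos hεβ).atTop_mul_const (show 0 < G / 2 by positivity)
    refine h2.congr' ?_
    filter_upwards [hncast.eventually_gt_atTop 0] with n hn
    have : (n : ℝ) ^ (1 - β) * (n : ℝ) ^ β = n := by
      rw [← Real.rpow_add hn]; simp
    calc _ = ((n : ℝ) ^ (1 - β) * (n : ℝ) ^ β) * ε n * G / 2 := by ring
      _ = _ := by rw [this]
  have hratio : Tendsto (fun n : ℕ => n * (1 - F (μ n)) / D n ^ 2) atTop (nhds 0) := by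
    have h1 : Tendsto (fun n : ℕ => (n : ℝ) ^ (-(a' * ρ - (2 * β - 1)))) atTop (nhds 0) :=
      (tendsto_rpow_neg_atTop hκ).comp hncast
    have h2 : Tendsto (fun n : ℕ => (n : ℝ) ^ (-(a' * ρ - (2 * β - 1))) *
        (4 / (((n : ℝ) ^ β * ε n) ^ 2 * G ^ 2))) atTop (nhds 0) := by
      have h3 := ((hεβ.pow 2).mul_const (G ^ 2))
      have h4 := h1.mul ((tendsto_const_nhds (x := (4 : ℝ))).div h3 (by positivity))
      simpa using h4
    refine squeeze_zero' ?_ ?_ h2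
    · exact Eventually.of_forall fun n => by
        have := (hFbar (μ n)).le
        positivity
    · filter_upwards [hp, hncast.eventually_gt_atTop 0] with n h hn
      have hε0 := (hε n).1
      have e : (n : ℝ) ^ (-(a' * ρ - (2 * β - 1))) *
          (4 / (((n : ℝ) ^ β * ε n) ^ 2 * G ^ 2)) = n * (n : ℝ) ^ (-(a' * ρ)) / D n ^ 2 := by
        have e1 : (n : ℝ) ^ (-(a' * ρ - (2 * β - 1))) =
            (n : ℝ) ^ (-(a' * ρ)) * ((n : ℝ) ^ β) ^ 2 / n := by
          rw [← Real.rpow_natCast ((n : ℝ) ^ β), ← Real.rpow_mul hn.le, ← Real.rpow_add hn,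
            ← Real.rpow_sub_one hn.ne']
          congr 1; push_cast; ring
        have hb : 0 < (n : ℝ) ^ β := Real.rpow_pos_of_pos hn _
        rw [e1]
        simp only [D]
        field_simp
        try norm_num
      rw [e]
      gcongr
  have hpz : ∀ᶠ n : ℕ in atTop, 1 - F (μ n) ≤ G / 2 := by
    have h1 : Tendsto (fun n => 1 - F (μ n)) atTop (nhds (1 - 1)) :=
      (hFtop.comp hμtop).const_sub 1
    exact h1.eventually_le_const (by simpa using hGpos)
  have hlow : Tendsto (fun n : ℕ => 1 - 4 * (n * (1 - F (μ n)) / D n ^ 2 + 1 / D n))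
      atTop (nhds 1) := by
    have := ((hratio.add (hDtop.const_div_atTop 1)).const_mul 4).const_sub 1
    simpa using this
  have hq : ∀ n t, 0 ≤ (1 - ε n) * (1 - F t) + ε n * (1 - F (t - μ n)) ∧
      (1 - ε n) * (1 - F t) + ε n * (1 - F (t - μ n)) ≤ 1 := by
    intro n t
    have h1 := (hε n).1
    have h2 := (hε n).2
    have h3 := (hFbar t).le
    have h4 := (hFbar (t - μ n)).le
    have h5 := hF0 t
    have h6 := hF0 (t - μ n)
    have h7 : 0 ≤ 1 - ε n := by linarith
    exact ⟨by positivity, by nlinarith [mul_nonneg h7 h5, mul_nonneg h1.le h6]⟩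
  have hle : ∀ n t, binomTail n ((1 - ε n) * (1 - F t) + ε n * (1 - F (t - μ n)))
      (critVal n (1 - F t) α) ≤ 1 := fun n t =>
    binomTail_le_one n _ (hq n t).1 (hq n t).2 _
  refine tendsto_of_tendsto_of_tendsto_of_le_of_le' hlow tendsto_const_nhds ?_
    (Eventually.of_forall fun n => ciSup_le (hle n))
  filter_upwards [hpz, hDtop.eventually_ge_atTop 4,
    hratio.eventually_le_const (show 0 < α / 16 by positivity)] with n h1 h2 h3
  refine le_trans ?_ (le_ciSup (f := fun t => binomTail n
    ((1 - ε n) * (1 - F t) + ε n * (1 - F (t - μ n))) (critVal n (1 - F t) α))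
    ⟨1, by rintro _ ⟨t, rfl⟩; exact hle n t⟩ (μ n))
  refine power_lower n _ _ α (D n) (hFbar _).le (by linarith [hF0 (μ n)]) (hq n _).1 (hq n _).2
    h2 ?_ h3
  rw [sub_self]
  have h4 : 0 ≤ (n : ℝ) * ε n := mul_nonneg (Nat.cast_nonneg n) (hε n).1.le
  have h5 := mul_le_mul_of_nonneg_left h1 h4
  simp only [D]
  rw [← hG]
  nlinarith
end

section
/- Let F be a continuous cumulative distribution function, let x₁ < x₂ < ⋯ < x_n be distinct reals, and for s ≤ t define N[s,t] = #{i : s ≤ x_i ≤ t} and R(s,t) = (N[s,t] − n F[s,t]) / √(n F[s,t](1 − F[s,t]) + 1), where F[s,t] = F(t) − F(s). Then the supremum of R(s,t) over all pairs s ≤ t with F[s,t] ≤ 1/2 is attained at a pair of data points: it equals the maximum of R(x_i, x_j) over all 1 ≤ i ≤ j ≤ n with F[x_i, x_j] ≤ 1/2. -/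
open Filter

/-- The supremum of the standardized scan count `R(s,t)` over all pairs `s ≤ t` with
`F[s,t] ≤ 1/2` is attained at a pair of data points. -/
theorem scan_sup_attained_at_data_points
    (F : ℝ → ℝ) (hFcont : Continuous F) (hFmono : Monotone F)
    (hFbot : Tendsto F atBot (nhds 0)) (hFtop : Tendsto F atTop (nhds 1))
    (n : ℕ) (hn : 0 < n) (x : Fin n → ℝ) (hx : StrictMono x) :
    ∃ i j : Fin n, i ≤ j ∧ F (x j) - F (x i) ≤ 1 / 2 ∧
      IsGreatest
        {z : ℝ | ∃ s t : ℝ, s ≤ t ∧ F t - F s ≤ 1 / 2 ∧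
          z = (((Finset.univ.filter (fun k : Fin n => x k ∈ Set.Icc s t)).card : ℝ)
                - n * (F t - F s)) /
              Real.sqrt (n * (F t - F s) * (1 - (F t - F s)) + 1)}
        ((((Finset.univ.filter (fun k : Fin n => x k ∈ Set.Icc (x i) (x j))).card : ℝ)
            - n * (F (x j) - F (x i))) /
          Real.sqrt (n * (F (x j) - F (x i)) * (1 - (F (x j) - F (x i))) + 1)) := by
  classical
  let N : ℝ → ℝ → ℝ := fun s t =>
    ((Finset.univ.filter (fun k : Fin n => x k ∈ Set.Icc s t)).card : ℝ)
  let R : ℝ → ℝ → ℝ := fun s t => (N s t - n * (F t - F s)) /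
    Real.sqrt (n * (F t - F s) * (1 - (F t - F s)) + 1)
  let P : Finset (Fin n × Fin n) :=
    Finset.univ.filter (fun q => q.1 ≤ q.2 ∧ F (x q.2) - F (x q.1) ≤ 1 / 2)
  have hP : ∀ i, (i, i) ∈ P := by
    intro i
    simp [P]
  obtain ⟨⟨i, j⟩, hij, hmax⟩ :=
    Finset.exists_max_image P (fun q => R (x q.1) (x q.2)) ⟨(⟨0, hn⟩, ⟨0, hn⟩), hP _⟩
  have hmax' : ∀ a b, (a, b) ∈ P → R (x a) (x b) ≤ R (x i) (x j) :=
    fun a b h => hmax (a, b) h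
  clear hmax
  have hij2 : i ≤ j ∧ F (x j) - F (x i) ≤ 1 / 2 := by simpa [P] using hij
  refine ⟨i, j, hij2.1, hij2.2, ⟨x i, x j, hx.monotone hij2.1, hij2.2, rfl⟩, ?_⟩
  rintro z ⟨s, t, hst, hF, rfl⟩
  change R s t ≤ R (x i) (x j)
  have hn' : (0 : ℝ) < n := by exact_mod_cast hn
  rcases le_or_gt (N s t - n * (F t - F s)) 0 with h0 | h0
  · have h1 : R s t ≤ 0 := div_nonpos_of_nonpos_of_nonneg h0 (Real.sqrt_nonneg _)
    have h2 : 0 ≤ R (x ⟨0, hn⟩) (x ⟨0, hn⟩) := by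
      have e : R (x ⟨0, hn⟩) (x ⟨0, hn⟩) = N (x ⟨0, hn⟩) (x ⟨0, hn⟩) / Real.sqrt 1 := by
        simp only [R, sub_self, mul_zero, sub_zero, zero_mul, zero_add]
      rw [e]
      exact div_nonneg (Nat.cast_nonneg _) (Real.sqrt_nonneg _)
    exact h1.trans (h2.trans (hmax' ⟨0, hn⟩ ⟨0, hn⟩ (hP ⟨0, hn⟩)))
  · have hp0 : 0 ≤ F t - F s := sub_nonneg.2 (hFmono hst)
    let S : Finset (Fin n) := Finset.univ.filter (fun k : Fin n => x k ∈ Set.Icc s t)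
    have hS : S.Nonempty := by
      rw [← Finset.card_pos]
      have : (0 : ℝ) < (S.card : ℝ) := by
        have h3 : 0 ≤ n * (F t - F s) := by positivity
        have h4 : N s t = (S.card : ℝ) := rfl
        linarith
      exact_mod_cast this
    have ha := S.min'_mem hS
    have hb := S.max'_mem hS
    have hab : S.min' hS ≤ S.max' hS := S.min'_le _ hb
    have hmin : ∀ k ∈ S, S.min' hS ≤ k := fun k hk => S.min'_le k hk
    have hmx : ∀ k ∈ S, k ≤ S.max' hS := fun k hk => S.le_max' k hk
    generalize S.min' hS = a at *
    generalize S.max' hS = b at *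
    have ha' : s ≤ x a ∧ x a ≤ t := by simpa [S] using ha
    have hb' : s ≤ x b ∧ x b ≤ t := by simpa [S] using hb
    have hN : N (x a) (x b) = N s t := by
      have : Finset.univ.filter (fun k : Fin n => x k ∈ Set.Icc (x a) (x b)) = S := by
        ext k
        constructor
        · intro hk
          have hk' : x a ≤ x k ∧ x k ≤ x b := by simpa using hk
          have : s ≤ x k ∧ x k ≤ t := ⟨ha'.1.trans hk'.1, hk'.2.trans hb'.2⟩
          simpa [S] using this
        · intro hk
          have : x a ≤ x k ∧ x k ≤ x b :=
            ⟨hx.monotone (hmin k hk), hx.monotone (hmx k hk)⟩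
          simpa using this
      simp only [N]
      rw [this]
    have hq0 : 0 ≤ F (x b) - F (x a) := sub_nonneg.2 (hFmono (hx.monotone hab))
    have hqp : F (x b) - F (x a) ≤ F t - F s := sub_le_sub (hFmono hb'.2) (hFmono ha'.1)
    have hmem : (a, b) ∈ P := by
      have : a ≤ b ∧ F (x b) - F (x a) ≤ 1 / 2 := ⟨hab, hqp.trans hF⟩
      simpa [P] using this
    refine le_trans ?_ (hmax' a b hmem)
    simp only [R, hN]
    generalize F (x b) - F (x a) = q at *
    generalize F t - F s = p at *
    have hmul : n * q ≤ n * p := mul_le_mul_of_nonneg_left hqp hn'.le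
    have hpos : 0 < n * q * (1 - q) + 1 := by
      have : 0 ≤ n * q * (1 - q) := mul_nonneg (by positivity) (by linarith)
      linarith
    have hle : n * q * (1 - q) + 1 ≤ n * p * (1 - p) + 1 := by
      have : 0 ≤ n * ((p - q) * (1 - p - q)) :=
        mul_nonneg hn'.le (mul_nonneg (by linarith) (by linarith))
      nlinarith
    exact div_le_div₀ (by linarith) (by linarith) (Real.sqrt_pos.2 hpos) (Real.sqrt_le_sqrt hle)
end

section
/- Let X₁,…,X_n be i.i.d. with continuous cumulative distribution function F, and let S_n = sup{ R_n(s,t) : s ≤ t, F[s,t] ≤ 1/2 } where R_n(s,t) = (N_n[s,t] − n F[s,t]) / √(n F[s,t](1 − F[s,t]) + 1), N_n[s,t] = #{i : s ≤ X_i ≤ t} and F[s,t] = F(t) − F(s). Then P(S_n ≥ 3 log n) → 0 as n → ∞. -/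
open Filter MeasureTheory

lemma aux_le (F : ℝ → ℝ) (hFcont : Continuous F)
    (hFbot : Tendsto F atBot (nhds 0)) (hFtop : Tendsto F atTop (nhds 1))
    (c : ℝ) (h0 : 0 < c) (h1 : c < 1) : ∃ y, F y = c := by
  have := mem_range_of_exists_le_of_exists_ge hFcont
    ((hFbot.eventually_lt_const h0).exists.imp fun _ h => h.le)
    ((hFtop.eventually_const_lt h1).exists.imp fun _ h => h.le)
  exact this

lemma meas_A (F : ℝ → ℝ) (hFcont : Continuous F) (hFmono : Monotone F)
    (hFbot : Tendsto F atBot (nhds 0)) (hFtop : Tendsto F atTop (nhds 1))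
    (μ : Measure ℝ) [IsProbabilityMeasure μ]
    (hcdf : ∀ t, μ (Set.Iic t) = ENNReal.ofReal (F t)) (a b : ℝ) (ha : 0 ≤ a) (ha1 : a ≤ 1)
    (hab : a ≤ b) : μ.real {x | a ≤ F x ∧ F x ≤ b} ≤ b - a := by
  have hF0 : ∀ y, 0 ≤ F y := fun y => hFmono.le_of_tendsto hFbot y
  have hreal : ∀ y, μ.real (Set.Iic y) = F y := fun y => by
    rw [Measure.real, hcdf, ENNReal.toReal_ofReal (hF0 y)]
  have h1 : μ.real {x | F x ≤ b} ≤ b := by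
    apply le_of_forall_gt_imp_ge_of_dense
    intro c hc
    by_cases hc1 : c < 1
    · obtain ⟨y, rfl⟩ := aux_le F hFcont hFbot hFtop c (by linarith) hc1
      rw [← hreal y]
      refine measureReal_mono ?_
      intro x hx
      exact le_of_not_gt fun h => absurd (hFmono h.le) (not_le.2 (lt_of_le_of_lt hx hc))
    · exact measureReal_le_one.trans (not_lt.1 hc1)
  have h2 : a ≤ μ.real {x | F x < a} := by
    apply le_of_forall_lt_imp_le_of_dense
    intro c hc
    by_cases hc1 : 0 < c
    · obtain ⟨y, rfl⟩ := aux_le F hFcont hFbot hFtop c hc1 (by linarith)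
      rw [← hreal y]
      refine measureReal_mono ?_
      intro x hx
      exact lt_of_le_of_lt (hFmono hx) hc
    · exact (not_lt.1 hc1).trans measureReal_nonneg
  have h3 : {x | a ≤ F x ∧ F x ≤ b} = {x | F x ≤ b} \ {x | F x < a} := by
    ext x; simp [and_comm]
  have hsub : {x | F x < a} ⊆ {x | F x ≤ b} := fun x (hx : F x < a) => (hx.le.trans hab : F x ≤ b)
  rw [h3, measureReal_sdiff hsub
    (measurableSet_lt hFcont.measurable measurable_const)]
  linarith

lemma chernoff (μ : Measure ℝ) [IsProbabilityMeasure μ] (n : ℕ) (A : Set ℝ) (hA : MeasurableSet A)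
    (q : ℝ) (hq : μ.real A ≤ q) (l T : ℝ) (hl : 0 ≤ l) :
    (Measure.pi fun _ : Fin n => μ).real {ω : Fin n → ℝ | T ≤ ∑ i, A.indicator (fun _ => (1:ℝ)) (ω i)}
      ≤ Real.exp (-l * T + n * q * (Real.exp l - 1)) := by
  set P := Measure.pi fun _ : Fin n => μ
  set g : ℝ → ℝ := fun x => Real.exp (l * A.indicator (fun _ => (1:ℝ)) x)
  have hg : ∀ x, g x = 1 + A.indicator (fun _ => Real.exp l - 1) x := by
    intro x
    by_cases hx : x ∈ A <;> simp [g, hx]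
  have hgm : Measurable g := by
    apply Real.measurable_exp.comp
    exact (measurable_const.indicator hA).const_mul l
  have hexp : ∀ ω : Fin n → ℝ, Real.exp (l * ∑ i, A.indicator (fun _ => (1:ℝ)) (ω i)) = ∏ i, g (ω i) := by
    intro ω
    rw [Finset.mul_sum, Real.exp_sum]
  have hE : 0 ≤ Real.exp l - 1 := by linarith [Real.one_le_exp hl]
  have hint : Integrable (fun x => A.indicator (fun _ => Real.exp l - 1) x) μ :=
    (integrable_const _).indicator hA
  have hgi : Integrable g μ := by
    rw [show g = fun x => 1 + A.indicator (fun _ => Real.exp l - 1) x from funext hg]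
    exact (integrable_const _).add hint
  have hgv : ∫ x, g x ∂μ ≤ Real.exp (q * (Real.exp l - 1)) := by
    simp_rw [hg]
    rw [integral_add (integrable_const _) hint, integral_indicator_const _ hA]
    simp only [integral_const, probReal_univ, smul_eq_mul, mul_one]
    have := Real.add_one_le_exp (q * (Real.exp l - 1))
    nlinarith
  have := ProbabilityTheory.measure_ge_le_exp_mul_mgf (μ := P)
    (X := fun ω : Fin n → ℝ => ∑ i, A.indicator (fun _ => (1:ℝ)) (ω i)) T hl
    (by simp_rw [hexp]; exact Integrable.fintype_prod (fun _ => hgi))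
  refine this.trans ?_
  rw [Real.exp_add]
  gcongr
  rw [ProbabilityTheory.mgf]
  simp_rw [hexp]
  rw [integral_fintype_prod_eq_prod (f := fun _ => g)]
  rw [Finset.prod_const, Finset.card_univ, Fintype.card_fin, mul_assoc, Real.exp_nat_mul]
  gcongr

lemma chern2 (μ : Measure ℝ) [IsProbabilityMeasure μ] (n : ℕ) (A : Set ℝ) (hA : MeasurableSet A)
    (m x : ℝ) (hm : 0 ≤ m) (hn : 0 < n) (hq : μ.real A ≤ m / n) (u : ℝ) (hu1 : 1 ≤ u) (hu : m / 2 ≤ u) :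
    (Measure.pi fun _ : Fin n => μ).real
      {ω : Fin n → ℝ | m - 2 + x * √u ≤ ∑ i, A.indicator (fun _ => (1:ℝ)) (ω i)}
      ≤ Real.exp (4 - x) := by
  have hs : 1 ≤ √u := Real.one_le_sqrt.2 hu1
  have hs0 : 0 < √u := by linarith
  set l := 1 / √u with hl
  have hl0 : 0 < l := by positivity
  have hl1 : l ≤ 1 := by rw [hl, div_le_one hs0]; exact hs
  have hlu : l * √u = 1 := by rw [hl]; field_simp
  refine (chernoff μ n A hA _ hq l _ hl0.le).trans ?_
  apply Real.exp_le_exp.2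
  have h1 := Real.abs_exp_sub_one_sub_id_le (x := l) (by rw [abs_of_pos hl0]; exact hl1)
  have h2 := (abs_le.1 h1).2
  have h3 : (n:ℝ) * (m / n) = m := by field_simp
  have h4 : l ^ 2 * u = 1 := by
    rw [hl, div_pow, Real.sq_sqrt (by linarith)]; field_simp
  rw [h3]
  have h5 : m * l ^ 2 ≤ 2 := by nlinarith [sq_nonneg l]
  have h6 : m * (Real.exp l - 1 - l) ≤ 2 := (mul_le_mul_of_nonneg_left h2 hm).trans h5
  have h7 : x * (l * √u) = x := by rw [hlu, mul_one]
  nlinarith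

theorem stouffer_scan_null_control
    (F : ℝ → ℝ) (hFcont : Continuous F) (hFmono : Monotone F)
    (hFbot : Tendsto F atBot (nhds 0)) (hFtop : Tendsto F atTop (nhds 1))
    (μ : Measure ℝ) [IsProbabilityMeasure μ]
    (hcdf : ∀ t, μ (Set.Iic t) = ENNReal.ofReal (F t)) :
    Tendsto (fun n : ℕ =>
        (Measure.pi fun _ : Fin n => μ)
          {ω : Fin n → ℝ | 3 * Real.log n ≤
            sSup {z : ℝ | ∃ s t : ℝ, s ≤ t ∧ F t - F s ≤ 1 / 2 ∧
              z = (((Finset.univ.filter (fun i : Fin n => ω i ∈ Set.Icc s t)).card : ℝ)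
                    - n * (F t - F s)) /
                  Real.sqrt (n * (F t - F s) * (1 - (F t - F s)) + 1)}})
      atTop (nhds 0) := by
  have hF0 : ∀ y, 0 ≤ F y := fun y => hFmono.le_of_tendsto hFbot y
  have hF1 : ∀ y, F y ≤ 1 := fun y => hFmono.ge_of_tendsto hFtop y
  have key : ∀ n : ℕ, 3 ≤ n → (Measure.pi fun _ : Fin n => μ)
          {ω : Fin n → ℝ | 3 * Real.log n ≤
            sSup {z : ℝ | ∃ s t : ℝ, s ≤ t ∧ F t - F s ≤ 1 / 2 ∧
              z = (((Finset.univ.filter (fun i : Fin n => ω i ∈ Set.Icc s t)).card : ℝ)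
                    - n * (F t - F s)) /
                  Real.sqrt (n * (F t - F s) * (1 - (F t - F s)) + 1)}}
        ≤ ENNReal.ofReal (4 * Real.exp 5 / n) := by
    intro n hn
    have hn0 : (0:ℝ) < n := by positivity
    have hn3 : (3:ℝ) ≤ n := by exact_mod_cast hn
    have hlog : 1 ≤ Real.log n := by
      rw [Real.le_log_iff_exp_le hn0]
      linarith [Real.exp_one_lt_d9]
    set x : ℝ := 3 * Real.log n - 1 with hx
    have hx0 : 0 ≤ x := by linarith
    set P := Measure.pi fun _ : Fin n => μ with hP
    set A : ℕ → ℕ → Set ℝ := fun j d =>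
      {y | (j:ℝ) / n ≤ F y ∧ F y ≤ ((j:ℝ) + d + 1) / n} with hAdef
    set u : ℕ → ℝ := fun d => max 1 (((d:ℝ) + 1) / 2) with hu
    set E : ℕ → ℕ → Set (Fin n → ℝ) := fun j d =>
      {ω | ((d:ℝ) + 1) - 2 + x * √(u d) ≤ ∑ i, (A j d).indicator (fun _ => (1:ℝ)) (ω i)} with hE
    have hAm : ∀ j d, MeasurableSet (A j d) := fun j d =>
      (measurableSet_le measurable_const hFcont.measurable).inter
        (measurableSet_le hFcont.measurable measurable_const)
    have hEb : ∀ j ∈ Finset.range (n+1), ∀ d, P.real (E j d) ≤ Real.exp (4 - x) := by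
      intro j hj d
      have hj' : (j:ℝ) ≤ n := by exact_mod_cast Nat.lt_succ_iff.1 (Finset.mem_range.1 hj)
      apply chern2 μ n _ (hAm j d) _ x (by positivity) (by omega) _ _ (le_max_left _ _)
        (le_max_right _ _)
      have := meas_A F hFcont hFmono hFbot hFtop μ hcdf ((j:ℝ)/n) (((j:ℝ) + d + 1) / n)
        (by positivity) ((div_le_one hn0).2 hj') (by gcongr; linarith [(Nat.cast_nonneg d : (0:ℝ) ≤ d)])
      refine this.trans (le_of_eq ?_)
      ring
    have hsub : {ω : Fin n → ℝ | 3 * Real.log n ≤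
            sSup {z : ℝ | ∃ s t : ℝ, s ≤ t ∧ F t - F s ≤ 1 / 2 ∧
              z = (((Finset.univ.filter (fun i : Fin n => ω i ∈ Set.Icc s t)).card : ℝ)
                    - n * (F t - F s)) /
                  Real.sqrt (n * (F t - F s) * (1 - (F t - F s)) + 1)}} ⊆
        ⋃ j ∈ Finset.range (n+1), ⋃ d ∈ Finset.range (n+1), E j d := by
      intro ω hω
      rw [Set.mem_ofPred_eq] at hω
      have hlt : x < 3 * Real.log n := by linarith
      obtain ⟨z, ⟨s, t, hst, hp, rfl⟩, hz⟩ := exists_lt_of_lt_csSup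
        (by exact ⟨_, 0, 0, le_rfl, by norm_num, rfl⟩) (hlt.trans_le hω)
      have hp0 : 0 ≤ F t - F s := sub_nonneg.2 (hFmono hst)
      have hnp0 : 0 ≤ n * (F t - F s) := by positivity
      have hv : n * (F t - F s) / 2 + 1 ≤ n * (F t - F s) * (1 - (F t - F s)) + 1 := by
        nlinarith
      have hv0 : 0 < √(n * (F t - F s) * (1 - (F t - F s)) + 1) :=
        Real.sqrt_pos.2 (by linarith)
      rw [lt_div_iff₀ hv0] at hz
      set j := ⌊n * F s⌋₊ with hj
      set k := ⌊n * F t⌋₊ with hk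
      have hjk : j ≤ k := Nat.floor_mono (by gcongr; exact hFmono hst)
      have hkn : k ≤ n := by
        have : n * F t ≤ n := by nlinarith [hF1 t]
        exact Nat.floor_le_of_le this
      obtain ⟨d, hd⟩ := Nat.exists_eq_add_of_le hjk
      have hdR : (k:ℝ) = j + d := by exact_mod_cast hd
      have j1 : (j:ℝ) ≤ n * F s := Nat.floor_le (mul_nonneg hn0.le (hF0 s))
      have j2 : n * F s < j + 1 := Nat.lt_floor_add_one _
      have k1 : (k:ℝ) ≤ n * F t := Nat.floor_le (mul_nonneg hn0.le (hF0 t))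
      have k2 : n * F t < k + 1 := Nat.lt_floor_add_one _
      simp only [Set.mem_iUnion, Finset.mem_range]
      refine ⟨j, by omega, d, by omega, ?_⟩
      rw [hE]
      simp only [Set.mem_ofPred_eq]
      have hN : (((Finset.univ.filter (fun i : Fin n => ω i ∈ Set.Icc s t)).card : ℝ)) ≤
          ∑ i, (A j d).indicator (fun _ => (1:ℝ)) (ω i) := by
        rw [Finset.card_filter]
        push_cast
        apply Finset.sum_le_sum
        intro i _
        split_ifs with h
        · have : ω i ∈ A j d := by
            constructor
            · rw [div_le_iff₀ hn0]
              have := hFmono h.1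
              nlinarith
            · rw [le_div_iff₀ hn0]
              have := hFmono h.2
              nlinarith
          rw [Set.indicator_of_mem this]
        · exact Set.indicator_nonneg (fun _ _ => zero_le_one) _
      have huv : √(u d) ≤ √(n * (F t - F s) * (1 - (F t - F s)) + 1) := by
        apply Real.sqrt_le_sqrt
        refine le_trans ?_ hv
        apply max_le <;> linarith
      have := mul_le_mul_of_nonneg_left huv hx0
      linarith
    have hEb' : ∀ j ∈ Finset.range (n+1), ∀ d, P (E j d) ≤ ENNReal.ofReal (Real.exp (4 - x)) := by
      intro j hj d
      rw [← ofReal_measureReal]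
      exact ENNReal.ofReal_le_ofReal (hEb j hj d)
    refine (measure_mono hsub).trans ((measure_biUnion_finset_le _ _).trans ?_)
    calc ∑ j ∈ Finset.range (n+1), P (⋃ d ∈ Finset.range (n+1), E j d)
        ≤ ∑ j ∈ Finset.range (n+1), ∑ d ∈ Finset.range (n+1), ENNReal.ofReal (Real.exp (4 - x)) := by
          apply Finset.sum_le_sum
          intro j hj
          refine (measure_biUnion_finset_le _ _).trans ?_
          exact Finset.sum_le_sum fun d _ => hEb' j hj d
      _ = ENNReal.ofReal (((n:ℝ)+1) * (((n:ℝ)+1) * Real.exp (4 - x))) := by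
          rw [ENNReal.ofReal_mul (by positivity), ENNReal.ofReal_mul (by positivity)]
          simp [ENNReal.ofReal_add]
      _ ≤ _ := by
          apply ENNReal.ofReal_le_ofReal
          have h1 : Real.exp (4 - x) = Real.exp 5 / (n:ℝ)^3 := by
            rw [hx, show 4 - (3 * Real.log n - 1) = 5 - 3 * Real.log n by ring, Real.exp_sub]
            congr 1
            rw [← Real.exp_log hn0, ← Real.exp_nat_mul, Real.exp_log hn0]
            norm_num
          rw [h1, ← mul_assoc, ← mul_div_assoc, div_le_div_iff₀ (by positivity) hn0]
          have h2 : ((n:ℝ)+1) * (n+1) ≤ 4 * n^2 := by nlinarith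
          have h3 : 0 ≤ Real.exp 5 * n := by positivity
          nlinarith [mul_le_mul_of_nonneg_right h2 h3]
  have hlim : Tendsto (fun n : ℕ => ENNReal.ofReal (4 * Real.exp 5 / n)) atTop (nhds 0) := by
    have := ENNReal.tendsto_ofReal (tendsto_const_div_atTop_nhds_zero_nat (4 * Real.exp 5))
    simpa using this
  refine tendsto_of_tendsto_of_tendsto_of_le_of_le' tendsto_const_nhds hlim
    (Eventually.of_forall fun _ => zero_le) ?_
  filter_upwards [eventually_ge_atTop 3] with n hn
  exact key n hn
end

section
/- Assume nε_n → ∞ and √n·ε_n → 0, and let X₁,…,X_n be i.i.d. from the sparse mixture (1−ε_n)F(·) + ε_nF(·−μ_n). Suppose there is a sequence of intervals [s_n, t_n] with F[s_n,t_n] > 0 such that nε_n F[s_n−μ_n, t_n−μ_n]/log n → ∞ and nε_n² F[s_n−μ_n, t_n−μ_n]²/(F[s_n,t_n](log n)²) → ∞. Then P(S_n ≥ 3 log n) → 1, where S_n is the Stouffer scan statistic; hence the test rejecting when S_n ≥ 3 log n is asymptotically powerful. -/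
open Filter MeasureTheory

lemma count_cheb (n : ℕ) (ν : Measure ℝ) [IsProbabilityMeasure ν] (A : Set ℝ) (hA : MeasurableSet A)
    (c : ℝ) (hc : 0 < c) :
    (Measure.pi fun _ : Fin n => ν) {ω : Fin n → ℝ | c ≤ |∑ i, A.indicator (fun _ => (1:ℝ)) (ω i) - n * ν.real A|}
      ≤ ENNReal.ofReal (n * ν.real A / c ^ 2) := by
  set f : ℝ → ℝ := A.indicator (fun _ => (1:ℝ)) with hf
  have hfm : Measurable f := measurable_const.indicator hA
  have hfL : MemLp f 2 ν := (memLp_const (1:ℝ)).indicator hA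
  have hL : ∀ i : Fin n, MemLp (fun ω : Fin n → ℝ => f (ω i)) 2 (Measure.pi fun _ : Fin n => ν) := fun i =>
    hfL.comp_measurePreserving (measurePreserving_eval (fun _ : Fin n => ν) i)
  have hS : MemLp (∑ i, fun ω : Fin n → ℝ => f (ω i)) 2 (Measure.pi fun _ : Fin n => ν) :=
    memLp_finsetSum' _ (fun i _ => hL i)
  have hE : ∫ ω, (∑ i, fun ω : Fin n → ℝ => f (ω i)) ω ∂(Measure.pi fun _ : Fin n => ν) = n * ν.real A := by
    simp only [Finset.sum_apply]
    rw [integral_finsetSum _ (fun i _ => (hL i).integrable (by norm_num))]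
    have : ∀ i : Fin n, ∫ ω, f (ω i) ∂(Measure.pi fun _ : Fin n => ν) = ν.real A := fun i => by
      rw [integral_comp_eval (μ := fun _ : Fin n => ν) (f := f) hfm.aestronglyMeasurable]
      simp [hf, integral_indicator hA]
    simp [this]
  have hV : ProbabilityTheory.variance (∑ i, fun ω : Fin n → ℝ => f (ω i)) (Measure.pi fun _ : Fin n => ν) ≤ n * ν.real A := by
    rw [ProbabilityTheory.variance_sum_pi (fun _ => hfL)]
    have : ProbabilityTheory.variance f ν ≤ ν.real A := by
      refine (ProbabilityTheory.variance_le_expectation_sq hfm.aestronglyMeasurable).trans ?_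
      have : f ^ 2 = f := by
        ext x; by_cases hx : x ∈ A <;> simp [hf, hx]
      rw [this]
      simp [hf, integral_indicator hA]
    simp
    gcongr
  have := ProbabilityTheory.meas_ge_le_variance_div_sq hS hc
  rw [hE] at this
  simp only [Finset.sum_apply] at this
  refine this.trans (ENNReal.ofReal_le_ofReal ?_)
  gcongr

lemma det_bound (n l e p q N : ℝ) (hl : 1 ≤ l) (hn : 0 ≤ n) (he : 0 < e) (hp : 0 < p) (hq0 : 0 ≤ q) 
    (hq1 : q ≤ 1) (h0 : n * e ^ 2 ≤ 1 / 4) (h1 : 576 * l ≤ n * e * q) 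
    (h2 : 576 * (p * l ^ 2) ≤ n * e ^ 2 * q ^ 2)
    (hN : n * ((1 - e) * p + e * q) - n * e * q / 2 < N) :
    p ≤ 1 / 2 ∧ 3 * l ≤ (N - n * p) / Real.sqrt (n * p * (1 - p) + 1) := by
  have hpl : p ≤ p * l ^ 2 := le_mul_of_one_le_right hp.le (by nlinarith)
  have hpq : p ≤ q / 4 := by
    have : n * e ^ 2 * q ^ 2 ≤ 1 / 4 * q := by
      have : q ^ 2 ≤ q := by nlinarith
      nlinarith [sq_nonneg q]
    linarith
  have hp2 : p ≤ 1 / 2 := by linarith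
  refine ⟨hp2, ?_⟩
  have hnp : 0 ≤ n * p := by positivity
  have hnum : n * e * q / 4 ≤ N - n * p := by
    have : n * e * p ≤ n * e * (q / 4) := by gcongr
    nlinarith
  rw [le_div_iff₀ (by apply Real.sqrt_pos.2; nlinarith)]
  have hs : Real.sqrt (n * p * (1 - p) + 1) ≤ Real.sqrt (n * p) + 1 := by
    rw [Real.sqrt_le_left (by positivity)]
    nlinarith [Real.sq_sqrt hnp, Real.sqrt_nonneg (n * p)]
  have hs2 : 24 * l * Real.sqrt (n * p) ≤ n * e * q := by
    apply (sq_le_sq₀ (by positivity) (by positivity)).1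
    rw [mul_pow, Real.sq_sqrt hnp]
    have := mul_le_mul_of_nonneg_left h2 hn
    nlinarith
  nlinarith

lemma sSup_bdd (n : ℕ) (F : ℝ → ℝ) (hF : Monotone F) (ω : Fin n → ℝ) :
   BddAbove {z : ℝ | ∃ u v : ℝ, u ≤ v ∧ F v - F u ≤ 1 / 2 ∧
              z = (((Finset.univ.filter (fun i : Fin n => ω i ∈ Set.Icc u v)).card : ℝ)
                    - n * (F v - F u)) /
                  Real.sqrt (n * (F v - F u) * (1 - (F v - F u)) + 1)} := by
  refine ⟨n, ?_⟩
  rintro z ⟨u, v, huv, h, rfl⟩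
  have h0 : 0 ≤ F v - F u := sub_nonneg.2 (hF huv)
  have hn : (0:ℝ) ≤ n := Nat.cast_nonneg n
  have hs : 1 ≤ Real.sqrt (n * (F v - F u) * (1 - (F v - F u)) + 1) := by
    rw [Real.one_le_sqrt]
    have : 0 ≤ n * (F v - F u) * (1 - (F v - F u)) := mul_nonneg (by positivity) (by linarith)
    linarith
  rw [div_le_iff₀ (by linarith)]
  have hc : ((Finset.univ.filter (fun i : Fin n => ω i ∈ Set.Icc u v)).card : ℝ) ≤ n := by
    have := Finset.card_filter_le (Finset.univ : Finset (Fin n)) (fun i : Fin n => ω i ∈ Set.Icc u v)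
    simp only [Finset.card_univ, Fintype.card_fin] at this
    exact_mod_cast this
  nlinarith [mul_nonneg hn h0]

theorem stouffer_scan_test_powerful
    (F : ℝ → ℝ) (hFcont : Continuous F) (hFmono : Monotone F)
    (hFbot : Tendsto F atBot (nhds 0)) (hFtop : Tendsto F atTop (nhds 1))
    (ε : ℕ → ℝ) (hε : ∀ n, ε n ∈ Set.Ioc (0 : ℝ) (1 / 2))
    (μ : ℕ → ℝ) (hμ : ∀ n, 0 ≤ μ n)
    (hreg1 : Tendsto (fun n : ℕ => n * ε n) atTop atTop)
    (hreg2 : Tendsto (fun n : ℕ => Real.sqrt n * ε n) atTop (nhds 0))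
    (s t : ℕ → ℝ) (hst : ∀ n, s n ≤ t n) (hpos : ∀ n, 0 < F (t n) - F (s n))
    (h1 : Tendsto (fun n : ℕ =>
        n * ε n * (F (t n - μ n) - F (s n - μ n)) / Real.log n) atTop atTop)
    (h2 : Tendsto (fun n : ℕ =>
        n * ε n ^ 2 * (F (t n - μ n) - F (s n - μ n)) ^ 2
          / ((F (t n) - F (s n)) * Real.log n ^ 2)) atTop atTop)
    (ν : ℕ → Measure ℝ) [∀ n, IsProbabilityMeasure (ν n)]
    (hcdf : ∀ n u, ν n (Set.Iic u) =
      ENNReal.ofReal ((1 - ε n) * F u + ε n * F (u - μ n))) :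
    Tendsto (fun n : ℕ =>
        (Measure.pi fun _ : Fin n => ν n)
          {ω : Fin n → ℝ | 3 * Real.log n ≤
            sSup {z : ℝ | ∃ u v : ℝ, u ≤ v ∧ F v - F u ≤ 1 / 2 ∧
              z = (((Finset.univ.filter (fun i : Fin n => ω i ∈ Set.Icc u v)).card : ℝ)
                    - n * (F v - F u)) /
                  Real.sqrt (n * (F v - F u) * (1 - (F v - F u)) + 1)}})
      atTop (nhds 1) := by
  have hF0 : ∀ x, 0 ≤ F x := fun x => hFmono.le_of_tendsto hFbot x
  have hF1 : ∀ x, F x ≤ 1 := fun x => hFmono.ge_of_tendsto hFtop x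
  have hlim : Tendsto (fun n : ℕ => 1 - ENNReal.ofReal
      (4 * (n * ε n ^ 2 * (F (t n - μ n) - F (s n - μ n)) ^ 2
          / ((F (t n) - F (s n)) * Real.log n ^ 2))⁻¹ +
        4 * (n * ε n * (F (t n - μ n) - F (s n - μ n)) / Real.log n)⁻¹)) atTop (nhds 1) := by
    have := (h2.inv_tendsto_atTop.const_mul 4).add (h1.inv_tendsto_atTop.const_mul 4)
    have := ENNReal.tendsto_ofReal this
    have := ENNReal.Tendsto.sub (tendsto_const_nhds (x := (1:ENNReal))) this (Or.inl (by simp))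
    simpa using this
  have hreg3 : ∀ᶠ n : ℕ in atTop, (n:ℝ) * ε n ^ 2 ≤ 1 / 4 := by
    have : ∀ᶠ n : ℕ in atTop, Real.sqrt n * ε n < 1 / 2 := hreg2.eventually_lt_const (by norm_num)
    filter_upwards [this] with n hn
    have h0 : 0 ≤ Real.sqrt n * ε n := mul_nonneg (Real.sqrt_nonneg _) (hε n).1.le
    have := Real.sq_sqrt (Nat.cast_nonneg (α := ℝ) n)
    calc (n:ℝ) * ε n ^ 2 = (Real.sqrt n * ε n) ^ 2 := by rw [mul_pow, this]
      _ ≤ (1/2)^2 := by gcongr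
      _ = 1/4 := by norm_num
  have hlog : ∀ᶠ n : ℕ in atTop, 1 ≤ Real.log n :=
    (Real.tendsto_log_atTop.comp tendsto_natCast_atTop_atTop).eventually_ge_atTop 1
  refine tendsto_of_tendsto_of_tendsto_of_le_of_le' hlim tendsto_const_nhds ?_
    (Eventually.of_forall fun n => prob_le_one)
  filter_upwards [hreg3, hlog, h1.eventually_ge_atTop 576, h2.eventually_ge_atTop 576,
    eventually_gt_atTop 0] with n hr hl hx hy hn
  have hp := hpos n
  have he := (hε n).1
  have he2 := (hε n).2
  have hq0 : 0 ≤ F (t n - μ n) - F (s n - μ n) := sub_nonneg.2 (hFmono (by linarith [hst n]))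
  have hq1 : F (t n - μ n) - F (s n - μ n) ≤ 1 := by linarith [hF0 (s n - μ n), hF1 (t n - μ n)]
  have hreal : (ν n).real (Set.Ioc (s n) (t n)) = 
      (1 - ε n) * (F (t n) - F (s n)) + ε n * (F (t n - μ n) - F (s n - μ n)) := by
    have hc : ∀ u, (ν n).real (Set.Iic u) = (1 - ε n) * F u + ε n * F (u - μ n) := fun u => by
      rw [measureReal_def, hcdf, ENNReal.toReal_ofReal]
      have := hF0 u
      have := hF0 (u - μ n)
      have : 0 ≤ 1 - ε n := by linarith
      positivity
    have hd : Set.Ioc (s n) (t n) = Set.Iic (t n) \ Set.Iic (s n) := by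
      ext x; simp [and_comm]
    rw [hd, measureReal_diff (Set.Iic_subset_Iic.2 (hst n)) measurableSet_Iic, hc, hc]
    ring
  rw [le_div_iff₀ (by linarith)] at hx
  rw [le_div_iff₀ (by positivity)] at hy
  have hl0 : 0 < Real.log n := by linarith
  have hn0 : (0:ℝ) < n := by exact_mod_cast hn
  have hq : 0 < F (t n - μ n) - F (s n - μ n) := by
    rcases hq0.lt_or_eq with h | h
    · exact h
    · rw [← h] at hx; linarith
  set p := F (t n) - F (s n) with hpdef
  set q := F (t n - μ n) - F (s n - μ n) with hqdef
  have hch := count_cheb n (ν n) (Set.Ioc (s n) (t n)) measurableSet_Ioc (n * ε n * q / 2) (by positivity)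
  rw [hreal] at hch
  set E := {ω : Fin n → ℝ | n * ε n * q / 2 ≤ |∑ i, (Set.Ioc (s n) (t n)).indicator (fun _ => (1:ℝ)) (ω i) - n * ((1 - ε n) * p + ε n * q)|} with hE
  have hEm : MeasurableSet E := by
    have hm : Measurable ((Set.Ioc (s n) (t n)).indicator (fun _ => (1:ℝ))) :=
      measurable_const.indicator measurableSet_Ioc
    apply measurableSet_le measurable_const
    fun_prop
  calc _ ≤ 1 - (Measure.pi fun _ : Fin n => ν n) E := by
        apply tsub_le_tsub_left (hch.trans (ENNReal.ofReal_le_ofReal _))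
        have e1 : 4 * (n * ε n ^ 2 * q ^ 2 / (p * Real.log n ^ 2))⁻¹ = 4 * p / (n * ε n ^ 2 * q ^ 2) * Real.log n ^ 2 := by
          field_simp
        have e2 : 4 * (n * ε n * q / Real.log n)⁻¹ = 4 / (n * ε n * q) * Real.log n := by
          field_simp
        have e3 : n * ((1 - ε n) * p + ε n * q) / (n * ε n * q / 2) ^ 2 = (1 - ε n) * (4 * p / (n * ε n ^ 2 * q ^ 2)) + 4 / (n * ε n * q) := by
          field_simp
          ring
        rw [e1, e2, e3]
        have a1 : 0 < 4 * p / (n * ε n ^ 2 * q ^ 2) := by positivity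
        have a2 : 0 < 4 / (n * ε n * q) := by positivity
        have a3 : 1 ≤ Real.log n ^ 2 := by nlinarith
        nlinarith
    _ = (Measure.pi fun _ : Fin n => ν n) Eᶜ := (prob_compl_eq_one_sub hEm).symm
    _ ≤ _ := by
        apply measure_mono
        intro ω hω
        simp only [hE, Set.mem_compl_iff, Set.mem_setOf_eq, not_le] at hω
        have hω := (abs_lt.1 hω).1
        have hcard : ∑ i, (Set.Ioc (s n) (t n)).indicator (fun _ => (1:ℝ)) (ω i) ≤ 
            ((Finset.univ.filter (fun i : Fin n => ω i ∈ Set.Icc (s n) (t n))).card : ℝ) := by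
          rw [Finset.card_filter]
          push_cast
          apply Finset.sum_le_sum
          intro i _
          by_cases h : ω i ∈ Set.Ioc (s n) (t n)
          · have h' := Set.Ioc_subset_Icc_self h
            rw [Set.indicator_of_mem h, if_pos h']
          · rw [Set.indicator_of_notMem h]
            split_ifs <;> norm_num
        obtain ⟨b1, b2⟩ := det_bound n (Real.log n) (ε n) p q _ hl hn0.le he hp hq0 hq1 hr hx hy
          (lt_of_lt_of_le (by linarith) hcard)
        exact b2.trans (le_csSup (sSup_bdd n F hFmono ω) ⟨s n, t n, hst n, b1, rfl⟩)
end
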